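/- arXiv:2105.00971 — 8 statements merged into one kernel-verified Lean document; each statement's English description precedes it below -/
import Mathlib

section
/- Let k ≥ 2 and let n_1, …, n_k be positive integers. The number of triples (v, b, c) where v = (v_1,…,v_k) is a sequence of positive integers with v_i dividing n_i for each i, b = (b_1,…,b_k) is an integer sequence with b_1 = 0 satisfying, for every 1 ≤ j ≤ k−1, b_j ≤ b_{j+1}, b_j + v_j ≤ b_{j+1} + v_{j+1}, and b_{j+1} ≤ b_j + v_j − 1, and c = (c_1,…,c_k) is an integer sequence with c_1 = 0 satisfying, for every 1 ≤ j ≤ k−1, c_j ≤ c_{j+1}, c_j + n_j/v_j ≤ c_{j+1} + n_{j+1}/v_{j+1}, and c_{j+1} ≤ c_j + n_j/v_j − 1, equals ∑_{v_1 | n_1, …, v_k | n_k} ∏_{j=1}^{k−1} min(v_j, v_{j+1}) · min(n_j/v_j, n_{j+1}/v_{j+1}), where the sum ranges over all sequences of positive divisors v_i of n_i. -/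
/-- The sequences of left endpoints, starting at `0`, of chains of integer intervals of lengths
`h i` whose left and right endpoints weakly increase and whose consecutive members overlap. -/
noncomputable def overlapChains {m : ℕ} (h : Fin (m + 1) → ℕ) : Finset (Fin (m + 1) → ℤ) :=
  (Fintype.piFinset fun j : Fin m =>
    Finset.Icc (max 0 ((h j.castSucc : ℤ) - h j.succ)) ((h j.castSucc : ℤ) - 1)).image
      Fin.partialSum

theorem mem_overlapChains {m : ℕ} (h : Fin (m + 1) → ℕ) (b : Fin (m + 1) → ℤ) :
    b ∈ overlapChains h ↔ b ⟨0, by omega⟩ = 0 ∧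
        ∀ j : ℕ, ∀ hj : j + 1 < m + 1,
          b ⟨j, by omega⟩ ≤ b ⟨j + 1, hj⟩ ∧
          b ⟨j, by omega⟩ + (h ⟨j, by omega⟩ : ℤ) ≤ b ⟨j + 1, hj⟩ + (h ⟨j + 1, hj⟩ : ℤ) ∧
          b ⟨j + 1, hj⟩ ≤ b ⟨j, by omega⟩ + (h ⟨j, by omega⟩ : ℤ) - 1 := by
  simp only [overlapChains, Finset.mem_image, Fintype.mem_piFinset, Finset.mem_Icc]
  constructor
  · rintro ⟨f, hf, rfl⟩
    refine ⟨Fin.partialSum_zero f, fun j hj => ?_⟩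
    have hs := Fin.partialSum_succ f ⟨j, by omega⟩
    have hfj := hf ⟨j, by omega⟩
    simp only [Fin.castSucc_mk, Fin.succ_mk] at hs hfj
    omega
  · rintro ⟨h0, hb⟩
    refine ⟨fun j => b j.succ - b j.castSucc, fun j => ?_, ?_⟩
    · beta_reduce
      have := hb j.1 (by omega)
      change b j.castSucc ≤ b j.succ ∧ b j.castSucc + (h j.castSucc : ℤ) ≤
        b j.succ + (h j.succ : ℤ) ∧ b j.succ ≤ b j.castSucc + (h j.castSucc : ℤ) - 1 at this
      omega
    · funext i
      induction i using Fin.induction with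
      | zero => rw [Fin.partialSum_zero]; exact h0.symm
      | succ i ih => rw [Fin.partialSum_succ, ih]; ring

theorem card_overlapChains {m : ℕ} (h : Fin (m + 1) → ℕ) (hpos : ∀ i, 0 < h i) :
    (overlapChains h).card = ∏ j : Fin m, min (h j.castSucc) (h j.succ) := by
  rw [overlapChains, Finset.card_image_of_injective, Fintype.card_piFinset]
  · refine Finset.prod_congr rfl fun j _ => ?_
    have := hpos j.succ
    rw [Int.card_Icc]
    omega
  · intro f g hfg
    funext j
    have hf := Fin.partialSum_succ f j
    have hg := Fin.partialSum_succ g j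
    rw [hfg, hg] at hf
    exact (add_left_cancel hf).symm


/-- For `k ≥ 2` and positive integers `n 1, …, n k`, the number of
triples `(v, b, c)` encoding a parallelogram polycube of width `k` whose `i`-th plateau
has volume `n i` equals
`∑_{v 1 ∣ n 1, …, v k ∣ n k} ∏_{j=1}^{k-1} min (v j) (v (j+1)) * min (n j / v j) (n (j+1) / v (j+1))`. -/
theorem parallelogram_polycube_count_by_plateau_volumes
    (k : ℕ) (hk : 2 ≤ k) (n : Fin k → ℕ) (hn : ∀ i, 0 < n i) :
    Set.ncard {q : (Fin k → ℕ) × (Fin k → ℤ) × (Fin k → ℤ) |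
      (∀ i, 0 < q.1 i ∧ q.1 i ∣ n i) ∧
      (q.2.1 ⟨0, by omega⟩ = 0 ∧
        ∀ j : ℕ, ∀ hj : j + 1 < k,
          q.2.1 ⟨j, by omega⟩ ≤ q.2.1 ⟨j + 1, hj⟩ ∧
          q.2.1 ⟨j, by omega⟩ + (q.1 ⟨j, by omega⟩ : ℤ) ≤
            q.2.1 ⟨j + 1, hj⟩ + (q.1 ⟨j + 1, hj⟩ : ℤ) ∧
          q.2.1 ⟨j + 1, hj⟩ ≤ q.2.1 ⟨j, by omega⟩ + (q.1 ⟨j, by omega⟩ : ℤ) - 1) ∧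
      (q.2.2 ⟨0, by omega⟩ = 0 ∧
        ∀ j : ℕ, ∀ hj : j + 1 < k,
          q.2.2 ⟨j, by omega⟩ ≤ q.2.2 ⟨j + 1, hj⟩ ∧
          q.2.2 ⟨j, by omega⟩ + (n ⟨j, by omega⟩ / q.1 ⟨j, by omega⟩ : ℕ) ≤
            q.2.2 ⟨j + 1, hj⟩ + (n ⟨j + 1, hj⟩ / q.1 ⟨j + 1, hj⟩ : ℕ) ∧
          q.2.2 ⟨j + 1, hj⟩ ≤
            q.2.2 ⟨j, by omega⟩ + (n ⟨j, by omega⟩ / q.1 ⟨j, by omega⟩ : ℕ) - 1)} =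
    ∑ v ∈ Fintype.piFinset (fun i => (n i).divisors),
      ∏ j : Fin (k - 1),
        min (v ⟨j.1, by have := j.2; omega⟩) (v ⟨j.1 + 1, by have := j.2; omega⟩) *
        min (n ⟨j.1, by have := j.2; omega⟩ / v ⟨j.1, by have := j.2; omega⟩)
            (n ⟨j.1 + 1, by have := j.2; omega⟩ / v ⟨j.1 + 1, by have := j.2; omega⟩) := by
  obtain ⟨m, rfl⟩ : ∃ m, k = m + 1 := ⟨k - 1, by omega⟩
  trans (((Fintype.piFinset fun i => (n i).divisors).sigma fun v =>
      overlapChains v ×ˢ overlapChains fun i => n i / v i).map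
        (Equiv.sigmaEquivProd _ _).toEmbedding).card
  · rw [← Set.ncard_coe_finset]
    congr 1
    ext ⟨v, b, c⟩
    have hdiv : v ∈ Fintype.piFinset (fun i => (n i).divisors) ↔ ∀ i, 0 < v i ∧ v i ∣ n i := by
      simp only [Fintype.mem_piFinset, Nat.mem_divisors]
      exact forall_congr' fun i => ⟨fun h => ⟨Nat.pos_of_dvd_of_pos h.1 (hn i), h.1⟩,
        fun h => ⟨h.2, (hn i).ne'⟩⟩
    rw [Finset.mem_coe, Finset.mem_map_equiv]
    simp only [Equiv.sigmaEquivProd_symm_apply, Finset.mem_sigma, Finset.mem_product, hdiv,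
      mem_overlapChains, Set.mem_ofPred_eq]
  · rw [Finset.card_map, Finset.card_sigma]
    refine Finset.sum_congr rfl fun v hv => ?_
    have hv' : ∀ i, v i ∣ n i := fun i => Nat.dvd_of_mem_divisors (Fintype.mem_piFinset.1 hv i)
    have hpos : ∀ i, 0 < v i := fun i => Nat.pos_of_dvd_of_pos (hv' i) (hn i)
    rw [Finset.card_product, card_overlapChains _ hpos, card_overlapChains _ fun i =>
      Nat.div_pos (Nat.le_of_dvd (hn i) (hv' i)) (hpos i), ← Finset.prod_mul_distrib]
    rfl
end

section
/- For all real numbers x_1, x_2, x_3 > 3, one has V_3(x_1,x_2,x_3) = ζ_3(x_1, x_2−1, x_3−1) + ζ_3(x_1, x_3, x_2−2) + ζ_3(x_2, x_1−1, x_3−1) + ζ_3(x_2, x_3−1, x_1−1) + ζ_3(x_3, x_1, x_2−2) + ζ_3(x_3, x_2−1, x_1−1) + ζ_2(x_1+x_2−1, x_3−1) + ζ_2(x_1+x_3, x_2−2) + ζ_2(x_2+x_3−1, x_1−1) + ζ_2(x_3, x_1+x_2−2) + ζ_2(x_2, x_1+x_3−2) + ζ_2(x_1, x_2+x_3−2)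 + ζ_1(x_1+x_2+x_3−2), where V_3(x_1,x_2,x_3) = ∑_{n_1,n_2,n_3 ≥ 1} min(n_1,n_2)·min(n_2,n_3) / (n_1^{x_1} n_2^{x_2} n_3^{x_3}), and all the series involved converge absolutely. -/
/-- Summand of the Riemann zeta function `ζ₁(s) = ∑_{n ≥ 1} n⁻ˢ`. -/
noncomputable def zeta1Term (s : ℝ) (n : ℕ+) : ℝ := 1 / ((n : ℕ) : ℝ) ^ s

/-- Summand of the double zeta function `ζ₂(s,t) = ∑_{n₁ > n₂ ≥ 1} n₁⁻ˢ n₂⁻ᵗ`. -/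
noncomputable def zeta2Term (s t : ℝ) (p : {q : ℕ+ × ℕ+ // q.2 < q.1}) : ℝ :=
  1 / (((p.1.1 : ℕ) : ℝ) ^ s * ((p.1.2 : ℕ) : ℝ) ^ t)

/-- Summand of the triple zeta function
`ζ₃(s,t,u) = ∑_{n₁ > n₂ > n₃ ≥ 1} n₁⁻ˢ n₂⁻ᵗ n₃⁻ᵘ`. -/
noncomputable def zeta3Term (s t u : ℝ)
    (p : {q : ℕ+ × ℕ+ × ℕ+ // q.2.1 < q.1 ∧ q.2.2 < q.2.1}) : ℝ :=
  1 / (((p.1.1 : ℕ) : ℝ) ^ s * ((p.1.2.1 : ℕ) : ℝ) ^ t * ((p.1.2.2 : ℕ) : ℝ) ^ u)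

/-- The Riemann zeta function `ζ₁`. -/
noncomputable def zeta1 (s : ℝ) : ℝ := ∑' n, zeta1Term s n

/-- The double zeta function `ζ₂`. -/
noncomputable def zeta2 (s t : ℝ) : ℝ := ∑' p, zeta2Term s t p

/-- The triple zeta function `ζ₃`. -/
noncomputable def zeta3 (s t u : ℝ) : ℝ := ∑' p, zeta3Term s t u p

/-- Summand of the Dirichlet generating function of parallelogram polyominoes of
width `3`: `V₃(x₁,x₂,x₃) = ∑_{n₁,n₂,n₃ ≥ 1} min(n₁,n₂) min(n₂,n₃) n₁^{-x₁} n₂^{-x₂} n₃^{-x₃}`. -/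
noncomputable def V3Term (x₁ x₂ x₃ : ℝ) (n : ℕ+ × ℕ+ × ℕ+) : ℝ :=
  ((min n.1 n.2.1 : ℕ) * (min n.2.1 n.2.2 : ℕ) : ℝ) /
    (((n.1 : ℕ) : ℝ) ^ x₁ * ((n.2.1 : ℕ) : ℝ) ^ x₂ * ((n.2.2 : ℕ) : ℝ) ^ x₃)

/-- Transport a convergent sum along a bijection from its index type onto a set `s`. -/
theorem HasSum.indicator_of_bijOn {α β : Type*} {f : β → ℝ} {x : ℝ} {s : Set β} {g : α → β}
    (h : HasSum (fun a => f (g a)) x) (hg : Set.BijOn g Set.univ s) :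
    HasSum (s.indicator f) x := by
  have hinj : Function.Injective g := Set.injOn_univ.mp hg.injOn
  rw [← hinj.hasSum_iff (f := s.indicator f)]
  · convert h using 1
    funext a
    exact Set.indicator_of_mem (hg.mapsTo (Set.mem_univ a)) f
  · intro b hb
    refine Set.indicator_of_notMem (fun hbs => hb ?_) f
    obtain ⟨a, -, rfl⟩ := hg.surjOn hbs
    exact ⟨a, rfl⟩

theorem zeta1Term_summable {s : ℝ} (hs : 1 < s) : Summable (zeta1Term s) :=
  (Real.summable_one_div_nat_rpow.mpr hs).comp_injective PNat.coe_injective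

theorem zeta1Term_nonneg (s : ℝ) (n : ℕ+) : 0 ≤ zeta1Term s n := by
  unfold zeta1Term
  positivity

theorem zeta2Term_summable {s t : ℝ} (hs : 1 < s) (ht : 1 < t) : Summable (zeta2Term s t) := by
  have h := (zeta1Term_summable hs).mul_of_nonneg (zeta1Term_summable ht)
    (zeta1Term_nonneg s) (zeta1Term_nonneg t)
  refine (h.comp_injective Subtype.val_injective).congr fun p => ?_
  simp [zeta1Term, zeta2Term, mul_comm]

theorem zeta3Term_summable {s t u : ℝ} (hs : 1 < s) (ht : 1 < t) (hu : 1 < u) :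
    Summable (zeta3Term s t u) := by
  have h := (zeta1Term_summable hs).mul_of_nonneg
    ((zeta1Term_summable ht).mul_of_nonneg (zeta1Term_summable hu)
      (zeta1Term_nonneg t) (zeta1Term_nonneg u))
    (zeta1Term_nonneg s) (fun p => mul_nonneg (zeta1Term_nonneg t _) (zeta1Term_nonneg u _))
  refine (h.comp_injective Subtype.val_injective).congr fun p => ?_
  simp [zeta1Term, zeta3Term, mul_comm, mul_assoc]

/-- A sum over all triples of positive integers splits according to the thirteen weak orderings
of their entries. In each hypothesis name, the coordinates `a`, `b`, `c` are listed in decreasing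
order, equal ones being written together. -/
theorem hasSum_of_weakOrderings {F : ℕ+ × ℕ+ × ℕ+ → ℝ}
    {y_a_b_c y_a_c_b y_b_a_c y_b_c_a y_c_a_b y_c_b_a y_ab_c y_ac_b y_bc_a y_c_ab y_b_ac y_a_bc
      y_abc : ℝ}
    (h_a_b_c : HasSum (fun p : {q : ℕ+ × ℕ+ × ℕ+ // q.2.1 < q.1 ∧ q.2.2 < q.2.1} =>
      F (p.1.1, p.1.2.1, p.1.2.2)) y_a_b_c)
    (h_a_c_b : HasSum (fun p : {q : ℕ+ × ℕ+ × ℕ+ // q.2.1 < q.1 ∧ q.2.2 < q.2.1} =>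
      F (p.1.1, p.1.2.2, p.1.2.1)) y_a_c_b)
    (h_b_a_c : HasSum (fun p : {q : ℕ+ × ℕ+ × ℕ+ // q.2.1 < q.1 ∧ q.2.2 < q.2.1} =>
      F (p.1.2.1, p.1.1, p.1.2.2)) y_b_a_c)
    (h_b_c_a : HasSum (fun p : {q : ℕ+ × ℕ+ × ℕ+ // q.2.1 < q.1 ∧ q.2.2 < q.2.1} =>
      F (p.1.2.2, p.1.1, p.1.2.1)) y_b_c_a)
    (h_c_a_b : HasSum (fun p : {q : ℕ+ × ℕ+ × ℕ+ // q.2.1 < q.1 ∧ q.2.2 < q.2.1} =>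
      F (p.1.2.1, p.1.2.2, p.1.1)) y_c_a_b)
    (h_c_b_a : HasSum (fun p : {q : ℕ+ × ℕ+ × ℕ+ // q.2.1 < q.1 ∧ q.2.2 < q.2.1} =>
      F (p.1.2.2, p.1.2.1, p.1.1)) y_c_b_a)
    (h_ab_c : HasSum (fun p : {q : ℕ+ × ℕ+ // q.2 < q.1} =>
      F (p.1.1, p.1.1, p.1.2)) y_ab_c)
    (h_ac_b : HasSum (fun p : {q : ℕ+ × ℕ+ // q.2 < q.1} =>
      F (p.1.1, p.1.2, p.1.1)) y_ac_b)
    (h_bc_a : HasSum (fun p : {q : ℕ+ × ℕ+ // q.2 < q.1} =>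
      F (p.1.2, p.1.1, p.1.1)) y_bc_a)
    (h_c_ab : HasSum (fun p : {q : ℕ+ × ℕ+ // q.2 < q.1} =>
      F (p.1.2, p.1.2, p.1.1)) y_c_ab)
    (h_b_ac : HasSum (fun p : {q : ℕ+ × ℕ+ // q.2 < q.1} =>
      F (p.1.2, p.1.1, p.1.2)) y_b_ac)
    (h_a_bc : HasSum (fun p : {q : ℕ+ × ℕ+ // q.2 < q.1} =>
      F (p.1.1, p.1.2, p.1.2)) y_a_bc)
    (h_abc : HasSum (fun p : ℕ+ => F (p, p, p)) y_abc) :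
    HasSum F
      (y_a_b_c + y_a_c_b + y_b_a_c + y_b_c_a + y_c_a_b + y_c_b_a + y_ab_c + y_ac_b + y_bc_a
        + y_c_ab + y_b_ac + y_a_bc + y_abc) := by
  replace h_a_b_c := h_a_b_c.indicator_of_bijOn (s := {n | n.2.1 < n.1 ∧ n.2.2 < n.2.1})
    ⟨fun p _ => ⟨p.2.1, p.2.2⟩, fun p _ q _ hpq => by simp_all [Prod.ext_iff, Subtype.ext_iff], by
        rintro ⟨a, b, c⟩ ⟨h, h'⟩
        exact ⟨⟨(a, b, c), h, h'⟩, Set.mem_univ _, rfl⟩⟩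
  replace h_a_c_b := h_a_c_b.indicator_of_bijOn (s := {n | n.2.2 < n.1 ∧ n.2.1 < n.2.2})
    ⟨fun p _ => ⟨p.2.1, p.2.2⟩, fun p _ q _ hpq => by simp_all [Prod.ext_iff, Subtype.ext_iff], by
        rintro ⟨a, b, c⟩ ⟨h, h'⟩
        exact ⟨⟨(a, c, b), h, h'⟩, Set.mem_univ _, rfl⟩⟩
  replace h_b_a_c := h_b_a_c.indicator_of_bijOn (s := {n | n.1 < n.2.1 ∧ n.2.2 < n.1})
    ⟨fun p _ => ⟨p.2.1, p.2.2⟩, fun p _ q _ hpq => by simp_all [Prod.ext_iff, Subtype.ext_iff], by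
        rintro ⟨a, b, c⟩ ⟨h, h'⟩
        exact ⟨⟨(b, a, c), h, h'⟩, Set.mem_univ _, rfl⟩⟩
  replace h_b_c_a := h_b_c_a.indicator_of_bijOn (s := {n | n.2.2 < n.2.1 ∧ n.1 < n.2.2})
    ⟨fun p _ => ⟨p.2.1, p.2.2⟩, fun p _ q _ hpq => by simp_all [Prod.ext_iff, Subtype.ext_iff], by
        rintro ⟨a, b, c⟩ ⟨h, h'⟩
        exact ⟨⟨(b, c, a), h, h'⟩, Set.mem_univ _, rfl⟩⟩
  replace h_c_a_b := h_c_a_b.indicator_of_bijOn (s := {n | n.1 < n.2.2 ∧ n.2.1 < n.1})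
    ⟨fun p _ => ⟨p.2.1, p.2.2⟩, fun p _ q _ hpq => by simp_all [Prod.ext_iff, Subtype.ext_iff], by
        rintro ⟨a, b, c⟩ ⟨h, h'⟩
        exact ⟨⟨(c, a, b), h, h'⟩, Set.mem_univ _, rfl⟩⟩
  replace h_c_b_a := h_c_b_a.indicator_of_bijOn (s := {n | n.2.1 < n.2.2 ∧ n.1 < n.2.1})
    ⟨fun p _ => ⟨p.2.1, p.2.2⟩, fun p _ q _ hpq => by simp_all [Prod.ext_iff, Subtype.ext_iff], by
        rintro ⟨a, b, c⟩ ⟨h, h'⟩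
        exact ⟨⟨(c, b, a), h, h'⟩, Set.mem_univ _, rfl⟩⟩
  replace h_ab_c := h_ab_c.indicator_of_bijOn (s := {n | n.1 = n.2.1 ∧ n.2.2 < n.1})
    ⟨fun p _ => ⟨rfl, p.2⟩, fun p _ q _ hpq => by simp_all [Prod.ext_iff, Subtype.ext_iff], by
        rintro ⟨a, b, c⟩ ⟨h_eq, h⟩
        obtain rfl : a = b := h_eq
        exact ⟨⟨(a, c), h⟩, Set.mem_univ _, rfl⟩⟩
  replace h_ac_b := h_ac_b.indicator_of_bijOn (s := {n | n.1 = n.2.2 ∧ n.2.1 < n.1})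
    ⟨fun p _ => ⟨rfl, p.2⟩, fun p _ q _ hpq => by simp_all [Prod.ext_iff, Subtype.ext_iff], by
        rintro ⟨a, b, c⟩ ⟨h_eq, h⟩
        obtain rfl : a = c := h_eq
        exact ⟨⟨(a, b), h⟩, Set.mem_univ _, rfl⟩⟩
  replace h_bc_a := h_bc_a.indicator_of_bijOn (s := {n | n.2.1 = n.2.2 ∧ n.1 < n.2.1})
    ⟨fun p _ => ⟨rfl, p.2⟩, fun p _ q _ hpq => by simp_all [Prod.ext_iff, Subtype.ext_iff], by
        rintro ⟨a, b, c⟩ ⟨h_eq, h⟩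
        obtain rfl : b = c := h_eq
        exact ⟨⟨(b, a), h⟩, Set.mem_univ _, rfl⟩⟩
  replace h_c_ab := h_c_ab.indicator_of_bijOn (s := {n | n.1 < n.2.2 ∧ n.1 = n.2.1})
    ⟨fun p _ => ⟨p.2, rfl⟩, fun p _ q _ hpq => by simp_all [Prod.ext_iff, Subtype.ext_iff], by
        rintro ⟨a, b, c⟩ ⟨h, h_eq⟩
        obtain rfl : a = b := h_eq
        exact ⟨⟨(c, a), h⟩, Set.mem_univ _, rfl⟩⟩
  replace h_b_ac := h_b_ac.indicator_of_bijOn (s := {n | n.1 < n.2.1 ∧ n.1 = n.2.2})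
    ⟨fun p _ => ⟨p.2, rfl⟩, fun p _ q _ hpq => by simp_all [Prod.ext_iff, Subtype.ext_iff], by
        rintro ⟨a, b, c⟩ ⟨h, h_eq⟩
        obtain rfl : a = c := h_eq
        exact ⟨⟨(b, a), h⟩, Set.mem_univ _, rfl⟩⟩
  replace h_a_bc := h_a_bc.indicator_of_bijOn (s := {n | n.2.1 < n.1 ∧ n.2.1 = n.2.2})
    ⟨fun p _ => ⟨p.2, rfl⟩, fun p _ q _ hpq => by simp_all [Prod.ext_iff, Subtype.ext_iff], by
        rintro ⟨a, b, c⟩ ⟨h, h_eq⟩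
        obtain rfl : b = c := h_eq
        exact ⟨⟨(a, b), h⟩, Set.mem_univ _, rfl⟩⟩
  replace h_abc := h_abc.indicator_of_bijOn (s := {n | n.1 = n.2.1 ∧ n.2.1 = n.2.2})
    ⟨fun p _ => ⟨rfl, rfl⟩, fun p _ q _ hpq => by simp_all, by
        rintro ⟨a, b, c⟩ ⟨h_eq, h_eq'⟩
        obtain rfl : a = b := h_eq
        obtain rfl : a = c := h_eq'
        exact ⟨a, Set.mem_univ _, rfl⟩⟩
  have h := h_a_b_c |>.add h_a_c_b |>.add h_b_a_c |>.add h_b_c_a |>.add h_c_a_b |>.add h_c_b_a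
    |>.add h_ab_c |>.add h_ac_b |>.add h_bc_a |>.add h_c_ab |>.add h_b_ac |>.add h_a_bc
    |>.add h_abc
  convert h using 1
  funext n
  obtain ⟨a, b, c⟩ := n
  simp only [Set.indicator, Set.mem_ofPred_eq]
  rcases lt_trichotomy a b with hab | hab | hab <;>
    rcases lt_trichotomy b c with hbc | hbc | hbc <;>
    rcases lt_trichotomy a c with hac | hac | hac
  all_goals first
    | (exfalso; order)
    | simp [*, not_lt_of_gt, ne_of_gt, ne_of_lt]

theorem hasSum_zeta1 (s : ℝ) (hs : 1 < s) {f : ℕ+ → ℝ} (hf : ∀ n, f n = zeta1Term s n) :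
    HasSum f (zeta1 s) := by
  rw [funext hf]
  exact (zeta1Term_summable hs).hasSum

theorem hasSum_zeta2 (s t : ℝ) (hs : 1 < s) (ht : 1 < t)
    {f : {q : ℕ+ × ℕ+ // q.2 < q.1} → ℝ} (hf : ∀ p, f p = zeta2Term s t p) :
    HasSum f (zeta2 s t) := by
  rw [funext hf]
  exact (zeta2Term_summable hs ht).hasSum

theorem hasSum_zeta3 (s t u : ℝ) (hs : 1 < s) (ht : 1 < t) (hu : 1 < u)
    {f : {q : ℕ+ × ℕ+ × ℕ+ // q.2.1 < q.1 ∧ q.2.2 < q.2.1} → ℝ}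
    (hf : ∀ p, f p = zeta3Term s t u p) :
    HasSum f (zeta3 s t u) := by
  rw [funext hf]
  exact (zeta3Term_summable hs ht hu).hasSum

/-- For real `x₁, x₂, x₃ > 3`, the Dirichlet generating function of
parallelogram polyominoes of width `3` decomposes into multiple zeta values, all the
series involved being absolutely convergent. -/
theorem dirichlet_gf_parallelogram_polyominoes_width_three
    (x₁ x₂ x₃ : ℝ) (h₁ : 3 < x₁) (h₂ : 3 < x₂) (h₃ : 3 < x₃) :
    Summable (V3Term x₁ x₂ x₃) ∧
    Summable (zeta3Term x₁ (x₂ - 1) (x₃ - 1)) ∧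
    Summable (zeta3Term x₁ x₃ (x₂ - 2)) ∧
    Summable (zeta3Term x₂ (x₁ - 1) (x₃ - 1)) ∧
    Summable (zeta3Term x₂ (x₃ - 1) (x₁ - 1)) ∧
    Summable (zeta3Term x₃ x₁ (x₂ - 2)) ∧
    Summable (zeta3Term x₃ (x₂ - 1) (x₁ - 1)) ∧
    Summable (zeta2Term (x₁ + x₂ - 1) (x₃ - 1)) ∧
    Summable (zeta2Term (x₁ + x₃) (x₂ - 2)) ∧
    Summable (zeta2Term (x₂ + x₃ - 1) (x₁ - 1)) ∧
    Summable (zeta2Term x₃ (x₁ + x₂ - 2)) ∧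
    Summable (zeta2Term x₂ (x₁ + x₃ - 2)) ∧
    Summable (zeta2Term x₁ (x₂ + x₃ - 2)) ∧
    Summable (zeta1Term (x₁ + x₂ + x₃ - 2)) ∧
    ∑' n, V3Term x₁ x₂ x₃ n =
      zeta3 x₁ (x₂ - 1) (x₃ - 1) + zeta3 x₁ x₃ (x₂ - 2) + zeta3 x₂ (x₁ - 1) (x₃ - 1) +
      zeta3 x₂ (x₃ - 1) (x₁ - 1) + zeta3 x₃ x₁ (x₂ - 2) + zeta3 x₃ (x₂ - 1) (x₁ - 1) +
      zeta2 (x₁ + x₂ - 1) (x₃ - 1) + zeta2 (x₁ + x₃) (x₂ - 2) +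
      zeta2 (x₂ + x₃ - 1) (x₁ - 1) + zeta2 x₃ (x₁ + x₂ - 2) +
      zeta2 x₂ (x₁ + x₃ - 2) + zeta2 x₁ (x₂ + x₃ - 2) +
      zeta1 (x₁ + x₂ + x₃ - 2) := by
  have pos (n : ℕ+) : (0 : ℝ) < (n : ℕ) := Nat.cast_pos.mpr n.pos
  have hV := hasSum_of_weakOrderings (F := V3Term x₁ x₂ x₃)
    (hasSum_zeta3 x₁ (x₂ - 1) (x₃ - 1) (by linarith) (by linarith) (by linarith)
      fun ⟨⟨u, v, w⟩, huv, hvw⟩ =>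
      have huw := hvw.trans huv
      ?_)
    (hasSum_zeta3 x₁ x₃ (x₂ - 2) (by linarith) (by linarith) (by linarith)
      fun ⟨⟨u, v, w⟩, huv, hvw⟩ =>
      have huw := hvw.trans huv
      ?_)
    (hasSum_zeta3 x₂ (x₁ - 1) (x₃ - 1) (by linarith) (by linarith) (by linarith)
      fun ⟨⟨u, v, w⟩, huv, hvw⟩ =>
      have huw := hvw.trans huv
      ?_)
    (hasSum_zeta3 x₂ (x₃ - 1) (x₁ - 1) (by linarith) (by linarith) (by linarith)
      fun ⟨⟨u, v, w⟩, huv, hvw⟩ =>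
      have huw := hvw.trans huv
      ?_)
    (hasSum_zeta3 x₃ x₁ (x₂ - 2) (by linarith) (by linarith) (by linarith)
      fun ⟨⟨u, v, w⟩, huv, hvw⟩ =>
      have huw := hvw.trans huv
      ?_)
    (hasSum_zeta3 x₃ (x₂ - 1) (x₁ - 1) (by linarith) (by linarith) (by linarith)
      fun ⟨⟨u, v, w⟩, huv, hvw⟩ =>
      have huw := hvw.trans huv
      ?_)
    (hasSum_zeta2 (x₁ + x₂ - 1) (x₃ - 1) (by linarith) (by linarith) fun ⟨⟨u, v⟩, huv⟩ => ?_)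
    (hasSum_zeta2 (x₁ + x₃) (x₂ - 2) (by linarith) (by linarith) fun ⟨⟨u, v⟩, huv⟩ => ?_)
    (hasSum_zeta2 (x₂ + x₃ - 1) (x₁ - 1) (by linarith) (by linarith) fun ⟨⟨u, v⟩, huv⟩ => ?_)
    (hasSum_zeta2 x₃ (x₁ + x₂ - 2) (by linarith) (by linarith) fun ⟨⟨u, v⟩, huv⟩ => ?_)
    (hasSum_zeta2 x₂ (x₁ + x₃ - 2) (by linarith) (by linarith) fun ⟨⟨u, v⟩, huv⟩ => ?_)
    (hasSum_zeta2 x₁ (x₂ + x₃ - 2) (by linarith) (by linarith) fun ⟨⟨u, v⟩, huv⟩ => ?_)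
    (hasSum_zeta1 (x₁ + x₂ + x₃ - 2) (by linarith) fun u => ?_)
  · refine ⟨hV.summable, ?_, ?_, ?_, ?_, ?_, ?_, ?_, ?_, ?_, ?_, ?_, ?_, ?_, hV.tsum_eq⟩
    all_goals
      first
      | apply zeta3Term_summable
      | apply zeta2Term_summable
      | apply zeta1Term_summable
      all_goals linarith
  all_goals
    simp only [V3Term, zeta1Term, zeta2Term, zeta3Term, min_self, min_eq_left_of_lt,
      min_eq_right_of_lt, PNat.coe_lt_coe, *, Real.rpow_sub (pos _), Real.rpow_add (pos _),
      Real.rpow_one, Real.rpow_two]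
    have hu := pos u
    field_simp
end

section
/- Let k ≥ 1 and let f be any function from the set of k-tuples of positive integers to the extended nonnegative reals [0, ∞]. Then ∑_{n ∈ (ℕ_{>0})^k} f(n) = ∑_{l=1}^{k} ∑_{r} ∑_{m} f(m ∘ r), where the middle sum ranges over all surjective maps r : {1,…,k} → {1,…,l} and the inner sum ranges over all strictly decreasing sequences m_1 > m_2 > ⋯ > m_l of positive integers (so that (m ∘ r)_i = m_{r(i)}). -/
open scoped ENNReal

/-- Every finite tuple in a linear order factors uniquely as a surjection onto some `Fin l`
followed by a strictly decreasing tuple of length `l`. -/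
theorem bijective_comp_surjective_strictAnti {α ι : Type*} [LinearOrder α] [Fintype ι] :
    Function.Bijective
      (fun p : Σ l : ℕ, Σ _ : {r : ι → Fin l // Function.Surjective r},
          {m : Fin l → α // StrictAnti m} =>
        fun i => p.2.2.1 (p.2.1.1 i)) := by
  classical
  constructor
  · rintro ⟨l, ⟨r, hr⟩, m, hm⟩ ⟨l', ⟨r', hr'⟩, m', hm'⟩ h
    have hcomp : m ∘ r = m' ∘ r' := h
    have hrange : Set.range m = Set.range m' := by
      rw [← hr.range_comp m, hcomp, hr'.range_comp m']
    obtain rfl : l = l' := by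
      simpa [Set.ncard_range_of_injective hm.injective,
        Set.ncard_range_of_injective hm'.injective] using congrArg Set.ncard hrange
    obtain rfl : m = m' := by
      refine OrderDual.toDual.injective.comp_left ((hm.dual_right.range_inj hm'.dual_right).1 ?_)
      rw [Set.range_comp, Set.range_comp, hrange]
    obtain rfl : r = r' := hm.injective.comp_left hcomp
    rfl
  · intro n
    let s : Finset αᵒᵈ := Finset.univ.image fun i => OrderDual.toDual (n i)
    let e : Fin s.card ≃o s := s.orderIsoOfFin rfl
    have hs (i : ι) : OrderDual.toDual (n i) ∈ s :=
      Finset.mem_image_of_mem _ (Finset.mem_univ i)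
    refine ⟨⟨s.card, ⟨fun i => e.symm ⟨_, hs i⟩, fun j => ?_⟩,
      ⟨fun j => OrderDual.ofDual (e j).1, fun a b hab => ?_⟩⟩, ?_⟩
    · obtain ⟨i, -, hi⟩ := Finset.mem_image.1 (e j).2
      exact ⟨i, e.symm_apply_eq.2 (Subtype.ext hi)⟩
    · exact OrderDual.ofDual_lt_ofDual.2 (e.strictMono hab)
    · ext i
      simp

/-- Decomposition of a `k`-fold sum over positive integers according to
the relative order pattern (with possible equalities) of the indices: for any
`f : (ℕ+)^k → [0,∞]`,
`∑_{n} f n = ∑_{l=1}^{k} ∑_{r : {1,…,k} ↠ {1,…,l}} ∑_{m₁ > ⋯ > m_l ≥ 1} f (m ∘ r)`. -/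
theorem tsum_pnat_pi_eq_sum_surjections_strictAnti
    (k : ℕ) (hk : 1 ≤ k) (f : (Fin k → ℕ+) → ℝ≥0∞) :
    ∑' n : Fin k → ℕ+, f n =
      ∑ l ∈ Finset.Icc 1 k,
        ∑' r : {r : Fin k → Fin l // Function.Surjective r},
          ∑' m : {m : Fin l → ℕ+ // StrictAnti m},
            f (fun i => m.1 (r.1 i)) := by
  rw [← (Equiv.ofBijective _ bijective_comp_surjective_strictAnti).tsum_eq f, ENNReal.tsum_sigma']
  simp_rw [ENNReal.tsum_sigma']
  refine tsum_eq_sum fun l hl => ?_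
  have : IsEmpty {r : Fin k → Fin l // Function.Surjective r} := by
    refine ⟨fun ⟨r, hr⟩ => hl (Finset.mem_Icc.2 ⟨?_, ?_⟩)⟩
    · exact Nat.one_le_iff_ne_zero.2 fun h => (h ▸ r ⟨0, hk⟩ : Fin 0).elim0
    · simpa using Fintype.card_le_of_surjective r hr
  exact tsum_empty
end

section
/- Let k ≥ 1 and let x_1, …, x_k be real numbers with x_i > 3 for all i. Then ∑_{n_1,…,n_k ≥ 1} p(n_1,…,n_k) / (n_1^{x_1} ⋯ n_k^{x_k}) = ( ∑_{n_1,…,n_k ≥ 1} ∏_{j=1}^{k−1} min(n_j, n_{j+1}) / (n_1^{x_1} ⋯ n_k^{x_k}) )^2, where p(n_1,…,n_k) = ∑_{v_1 | n_1, …, v_k | n_k} ∏_{j=1}^{k−1} min(v_j, v_{j+1}) · min(n_j/v_j, n_{j+1}/v_{j+1}) (the sum being over all sequences of positive divisors v_i of n_i), and both series converge absolutely. In other words, the Dirichlet generating function of parallelogram polycubes is the square of the Dirichlet generating function of parallelogram polyominoes: P_k(x_1,…,x_k) = (V_k(x_1,…,x_k))^2. -/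
/-- The number of parallelogram polyominoes of width `k` whose `i`-th column has
height `n i`, namely `∏_{j=1}^{k-1} min (n j) (n (j+1))` (empty product for `k = 1`). -/
def polyominoCount (k : ℕ) (n : Fin k → ℕ+) : ℕ :=
  ∏ j : Fin (k - 1),
    min ((n ⟨j.1, by have := j.2; omega⟩ : ℕ)) ((n ⟨j.1 + 1, by have := j.2; omega⟩ : ℕ))

/-- The number of parallelogram polycubes of width `k` whose `i`-th plateau has
volume `n i`:
`p(n₁,…,n_k) = ∑_{v₁ ∣ n₁, …, v_k ∣ n_k} ∏_{j=1}^{k-1} min (v j) (v (j+1)) * min (n j / v j) (n (j+1) / v (j+1))`. -/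
def polycubeCount (k : ℕ) (n : Fin k → ℕ+) : ℕ :=
  ∑ v ∈ Fintype.piFinset (fun i => ((n i : ℕ)).divisors),
    ∏ j : Fin (k - 1),
      min (v ⟨j.1, by have := j.2; omega⟩) (v ⟨j.1 + 1, by have := j.2; omega⟩) *
      min ((n ⟨j.1, by have := j.2; omega⟩ : ℕ) / v ⟨j.1, by have := j.2; omega⟩)
          ((n ⟨j.1 + 1, by have := j.2; omega⟩ : ℕ) / v ⟨j.1 + 1, by have := j.2; omega⟩)

/-- Summand of the Dirichlet generating function `V_k` of parallelogram polyominoes. -/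
noncomputable def VTerm (k : ℕ) (x : Fin k → ℝ) (n : Fin k → ℕ+) : ℝ :=
  (polyominoCount k n : ℝ) / ∏ i, ((n i : ℕ) : ℝ) ^ x i

/-- Summand of the Dirichlet generating function `P_k` of parallelogram polycubes. -/
noncomputable def PTerm (k : ℕ) (x : Fin k → ℝ) (n : Fin k → ℕ+) : ℝ :=
  (polycubeCount k n : ℝ) / ∏ i, ((n i : ℕ) : ℝ) ^ x i

theorem Summable.fin_prod_of_nonneg {α : Type*} {k : ℕ} {f : Fin k → α → ℝ}
    (hf : ∀ i, Summable (f i)) (hf0 : ∀ i a, 0 ≤ f i a) :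
    Summable fun n : Fin k → α => ∏ i, f i (n i) := by
  induction k with
  | zero => exact Summable.of_finite
  | succ k ih =>
    rw [← (Fin.consEquiv fun _ => α).summable_iff]
    refine ((hf 0).mul_of_nonneg (ih (fun i => hf i.succ) fun i => hf0 i.succ) (hf0 0)
      fun n => Finset.prod_nonneg fun i _ => hf0 _ _).congr fun p => ?_
    simp [Fin.consEquiv, Fin.prod_univ_succ]

theorem polyominoCount_le_prod (k : ℕ) (n : Fin k → ℕ+) :
    polyominoCount k n ≤ ∏ i, (n i : ℕ) := by
  cases k with
  | zero => simp [polyominoCount]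
  | succ k =>
    rw [Fin.prod_univ_castSucc]
    exact (Finset.prod_le_prod' fun j _ => min_le_left _ _).trans
      (Nat.le_mul_of_pos_right _ (n (Fin.last k)).pos)

theorem VTerm_nonneg (k : ℕ) (x : Fin k → ℝ) (n : Fin k → ℕ+) : 0 ≤ VTerm k x n := by
  unfold VTerm
  positivity

theorem VTerm_le_prod (k : ℕ) (x : Fin k → ℝ) (n : Fin k → ℕ+) :
    VTerm k x n ≤ ∏ i, ((n i : ℕ) : ℝ) ^ (1 - x i) := by
  have h : ∏ i, ((n i : ℕ) : ℝ) ^ (1 - x i) =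
      (∏ i, ((n i : ℕ) : ℝ)) / ∏ i, ((n i : ℕ) : ℝ) ^ x i := by
    rw [← Finset.prod_div_distrib]
    refine Finset.prod_congr rfl fun i _ => ?_
    rw [Real.rpow_sub (by exact_mod_cast (n i).pos), Real.rpow_one]
  rw [h, VTerm]
  gcongr
  exact_mod_cast polyominoCount_le_prod k n

theorem summable_VTerm {k : ℕ} {x : Fin k → ℝ} (hx : ∀ i, 2 < x i) : Summable (VTerm k x) := by
  refine Summable.of_nonneg_of_le (VTerm_nonneg k x) (VTerm_le_prod k x)
    (Summable.fin_prod_of_nonneg (f := fun i (a : ℕ+) => ((a : ℕ) : ℝ) ^ (1 - x i))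
      (fun i => ?_) fun i a => by positivity)
  exact (Real.summable_nat_rpow.2 (by linarith [hx i])).comp_injective PNat.coe_injective

/-- Factorizations `n = a * b` of a tuple of positive integers correspond to tuples of divisors. -/
noncomputable def mulFiberEquivDivisors {ι : Type*} [Fintype ι] [DecidableEq ι] (n : ι → ℕ+) :
    {p : (ι → ℕ+) × (ι → ℕ+) // p.1 * p.2 = n} ≃
      Fintype.piFinset (fun i => (n i : ℕ).divisors) :=
  Equiv.ofBijective
    (fun p => ⟨fun i => p.1.1 i, by
      obtain ⟨⟨a, b⟩, rfl⟩ := p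
      simp⟩) <| by
    constructor
    · rintro ⟨⟨a, b⟩, h⟩ ⟨⟨c, d⟩, h'⟩ e
      have hac : a = c := funext fun i => PNat.coe_injective (congrFun (congrArg Subtype.val e) i)
      subst hac
      have hbd : b = d := mul_left_cancel (h.trans h'.symm)
      subst hbd
      rfl
    · rintro ⟨v, hv⟩
      simp only [Fintype.mem_piFinset, Nat.mem_divisors] at hv
      choose w hw using fun i => (hv i).1
      have hpos i : 0 < v i * w i := hw i ▸ (n i).pos
      refine ⟨⟨(fun i => ⟨v i, Nat.pos_of_mul_pos_right (hpos i)⟩,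
        fun i => ⟨w i, Nat.pos_of_mul_pos_left (hpos i)⟩), ?_⟩, rfl⟩
      exact funext fun i => PNat.coe_injective (hw i).symm

theorem coe_mulFiberEquivDivisors {ι : Type*} [Fintype ι] [DecidableEq ι] (n : ι → ℕ+)
    (p : {p : (ι → ℕ+) × (ι → ℕ+) // p.1 * p.2 = n}) :
    (mulFiberEquivDivisors n p : ι → ℕ) = fun i => (p.1.1 i : ℕ) :=
  rfl

theorem hasSum_VTerm_mul_VTerm_fiber (k : ℕ) (x : Fin k → ℝ) (n : Fin k → ℕ+) :
    HasSum (fun p : {p : (Fin k → ℕ+) × (Fin k → ℕ+) // p.1 * p.2 = n} =>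
      VTerm k x p.1.1 * VTerm k x p.1.2) (PTerm k x n) := by
  rw [PTerm, polycubeCount, Nat.cast_sum, Finset.sum_div]
  refine ((mulFiberEquivDivisors n).hasSum_iff.2 (Finset.hasSum _ _)).congr_fun ?_
  rintro ⟨⟨a, b⟩, rfl⟩
  have hdiv i : (a i * b i : ℕ) / (a i : ℕ) = b i := Nat.mul_div_cancel_left _ (a i).pos
  simp only [Function.comp_apply, coe_mulFiberEquivDivisors]
  simp [VTerm, polyominoCount, Finset.prod_mul_distrib, hdiv,
    Real.mul_rpow, div_mul_div_comm]

/-- For `k ≥ 1` and real `x i > 3`, the Dirichlet generating function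
of parallelogram polycubes is the square of that of parallelogram polyominoes:
`P_k(x₁,…,x_k) = (V_k(x₁,…,x_k))²`, both series converging absolutely. -/
theorem dirichlet_gf_parallelogram_polycubes_eq_sq
    (k : ℕ) (hk : 1 ≤ k) (x : Fin k → ℝ) (hx : ∀ i, 3 < x i) :
    Summable (PTerm k x) ∧ Summable (VTerm k x) ∧
    ∑' n, PTerm k x n = (∑' n, VTerm k x n) ^ 2 := by
  have hV : Summable (VTerm k x) := summable_VTerm fun i => by linarith [hx i]
  have hVV := hV.mul_of_nonneg hV (VTerm_nonneg k x) (VTerm_nonneg k x)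
  have hP : HasSum (PTerm k x) ((∑' n, VTerm k x n) * ∑' n, VTerm k x n) :=
    ((Equiv.sigmaFiberEquiv fun p : (Fin k → ℕ+) × (Fin k → ℕ+) => p.1 * p.2).hasSum_iff.2
      (hV.hasSum.mul hV.hasSum hVV)).sigma (hasSum_VTerm_mul_VTerm_fiber k x)
  exact ⟨hP.summable, hV, by rw [hP.tsum_eq, sq]⟩
end

section
/- Let k ≥ 1 and let x_1, …, x_k be real numbers with x_i > 2 for all i. Then the family ((n_1,…,n_k) ↦ ∏_{j=1}^{k−1} min(n_j, n_{j+1}) / (n_1^{x_1} ⋯ n_k^{x_k})), indexed by k-tuples of positive integers, is summable. -/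
/-- A product of nonnegative summable families, one for each coordinate, is summable over tuples. -/
theorem summable_pi_fin_prod_of_nonneg {α : Type*} (k : ℕ) (f : Fin k → α → ℝ)
    (hf : ∀ i, Summable (f i)) (hf0 : ∀ i a, 0 ≤ f i a) :
    Summable fun n : Fin k → α => ∏ i, f i (n i) := by
  induction k with
  | zero => exact Summable.of_finite
  | succ k ih =>
    have htail := ih (fun i => f i.succ) (fun i => hf i.succ) fun i => hf0 i.succ
    have hmul := (hf 0).mul_of_nonneg htail (hf0 0)
      fun n => Finset.prod_nonneg fun i _ => hf0 i.succ (n i)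
    rw [← (Fin.consEquiv fun _ : Fin (k + 1) => α).summable_iff]
    refine hmul.congr fun p => ?_
    simp [Fin.prod_univ_succ, Fin.consEquiv]

/-- The product of the minima of consecutive entries of a tuple of positive integers is at most
the product of its entries. -/
theorem prod_min_consecutive_le_prod (m : ℕ) (n : Fin (m + 1) → ℕ+) :
    ∏ j : Fin m, min (n j.castSucc : ℕ) (n j.succ : ℕ) ≤ ∏ i, (n i : ℕ) := by
  rw [Fin.prod_univ_castSucc]
  calc ∏ j : Fin m, min (n j.castSucc : ℕ) (n j.succ : ℕ)
      ≤ ∏ j : Fin m, (n j.castSucc : ℕ) := Finset.prod_le_prod' fun _ _ => min_le_left _ _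
    _ ≤ _ := Nat.le_mul_of_pos_right _ (n (Fin.last m)).pos

/-- For `k ≥ 1` and real `x i > 2`, the family
`(n₁,…,n_k) ↦ ∏_{j=1}^{k-1} min (n j) (n (j+1)) / (n₁^{x₁} ⋯ n_k^{x_k})`,
indexed by `k`-tuples of positive integers, is summable. -/
theorem summable_dirichlet_gf_parallelogram_polyominoes
    (k : ℕ) (hk : 1 ≤ k) (x : Fin k → ℝ) (hx : ∀ i, 2 < x i) :
    Summable (fun n : Fin k → ℕ+ =>
      ((∏ j : Fin (k - 1),
          min ((n ⟨j.1, by have := j.2; omega⟩ : ℕ))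
              ((n ⟨j.1 + 1, by have := j.2; omega⟩ : ℕ)) : ℕ) : ℝ) /
        ∏ i, ((n i : ℕ) : ℝ) ^ x i) := by
  obtain ⟨m, rfl⟩ : ∃ m, k = m + 1 := ⟨k - 1, by omega⟩
  have hdom : Summable fun n : Fin (m + 1) → ℕ+ => ∏ i, ((n i : ℕ) : ℝ) ^ (1 - x i) :=
    summable_pi_fin_prod_of_nonneg (m + 1) (fun i (a : ℕ+) => ((a : ℕ) : ℝ) ^ (1 - x i))
      (fun i => (Real.summable_nat_rpow.mpr (by linarith [hx i])).comp_injective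
        PNat.coe_injective)
      fun i a => by positivity
  refine hdom.of_nonneg_of_le (fun n => by positivity) fun n => ?_
  have hsplit : ∏ i, ((n i : ℕ) : ℝ) ^ (1 - x i)
      = ((∏ i, (n i : ℕ) : ℕ) : ℝ) / ∏ i, ((n i : ℕ) : ℝ) ^ x i := by
    rw [Nat.cast_prod, ← Finset.prod_div_distrib]
    refine Finset.prod_congr rfl fun i _ => ?_
    rw [Real.rpow_sub (by exact_mod_cast (n i).pos), Real.rpow_one]
  rw [hsplit]
  exact div_le_div_of_nonneg_right (Nat.cast_le.mpr (prod_min_consecutive_le_prod m n))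
    (by positivity)
end

section
/- Let k, n ≥ 1. The number of pairs of integer sequences ((b_1,…,b_k), (t_1,…,t_k)) with b_1 = 0 and t_k = n − 1, such that b_j ≤ b_{j+1} and t_j ≤ t_{j+1} for all 1 ≤ j ≤ k−1, b_i ≤ t_i for all 1 ≤ i ≤ k, and b_{j+1} ≤ t_j for all 1 ≤ j ≤ k−1, is g_{k,n} = (1/(k+n−1)) · C(k+n−1, k) · C(k+n−1, n); equivalently, (k+n−1) times this number equals C(k+n−1, k) · C(k+n−1, n), where C denotes the binomial coefficient. -/
/-- The pairs `(b, t)` of monotone sequences of length `m` with `0 ≤ b i ≤ t i`, `b i ≤ x`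
and `t i ≤ y`, built up by choosing the last entries `a` of `b` and `c` of `t`. -/
noncomputable def monotonePairs :
    (m : ℕ) → ℕ → ℕ → Finset ((Fin m → ℤ) × (Fin m → ℤ))
  | 0, _, _ => Finset.univ
  | m + 1, x, y => (Finset.range (x + 1)).biUnion fun a => (Finset.Icc a y).biUnion fun c =>
      (monotonePairs m a c).image fun p =>
        (Fin.snoc (α := fun _ => ℤ) p.1 (a : ℤ), Fin.snoc (α := fun _ => ℤ) p.2 (c : ℤ))

theorem Fin.monotone_snoc_iff {m : ℕ} {α : Type*} [Preorder α] (f : Fin m → α) (a : α) :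
    Monotone (Fin.snoc (α := fun _ => α) f a : Fin (m + 1) → α) ↔
      Monotone f ∧ ∀ i, f i ≤ a := by
  constructor
  · intro h
    refine ⟨fun i j hij => ?_, fun i => ?_⟩
    · simpa using h (Fin.castSucc_le_castSucc_iff.2 hij)
    · simpa using h (Fin.le_last i.castSucc)
  · rintro ⟨h, ha⟩ i j hij
    induction j using Fin.lastCases with
    | last =>
      induction i using Fin.lastCases with
      | last => simp
      | cast i => simpa using ha i
    | cast j =>
      induction i using Fin.lastCases with
      | last => exact absurd hij (not_le.2 (Fin.castSucc_lt_last j))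
      | cast i => simpa using h (Fin.castSucc_le_castSucc_iff.1 hij)

theorem mem_monotonePairs {m x y : ℕ} {p : (Fin m → ℤ) × (Fin m → ℤ)} :
    p ∈ monotonePairs m x y ↔ Monotone p.1 ∧ Monotone p.2 ∧
      ∀ i, 0 ≤ p.1 i ∧ p.1 i ≤ p.2 i ∧ p.1 i ≤ x ∧ p.2 i ≤ y := by
  induction m generalizing x y with
  | zero =>
    simp only [monotonePairs, Finset.mem_univ, true_iff]
    exact ⟨fun i => i.elim0, fun i => i.elim0, fun i => i.elim0⟩
  | succ m ih =>
    obtain ⟨b, t⟩ := p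
    induction b using Fin.snocCases with | _ b u
    induction t using Fin.snocCases with | _ t v
    simp only [monotonePairs, Finset.mem_biUnion, Finset.mem_range, Finset.mem_Icc,
      Finset.mem_image, ih, Prod.mk.injEq, Fin.snoc_inj, Fin.monotone_snoc_iff,
      Fin.forall_fin_succ', Fin.snoc_castSucc, Fin.snoc_last]
    constructor
    · rintro ⟨a, ha, c, ⟨hac, hc⟩, ⟨b', t'⟩, ⟨hb, ht, h⟩, ⟨rfl, rfl⟩, rfl, rfl⟩
      refine ⟨⟨hb, fun i => (h i).2.2.1⟩, ⟨ht, fun i => (h i).2.2.2⟩, fun i => ?_, by omega⟩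
      have := h i
      dsimp only at this ⊢
      omega
    · rintro ⟨⟨hb, hbu⟩, ⟨ht, htv⟩, h, hu, huv, hux, hvy⟩
      lift u to ℕ using hu
      lift v to ℕ using by omega
      exact ⟨u, by omega, v, by omega, (b, t),
        ⟨hb, ht, fun i => ⟨(h i).1, (h i).2.1, hbu i, htv i⟩⟩, ⟨rfl, rfl⟩, rfl, rfl⟩

theorem card_monotonePairs_succ (m x y : ℕ) :
    (monotonePairs (m + 1) x y).card =
      ∑ a ∈ Finset.range (x + 1), ∑ c ∈ Finset.Icc a y, (monotonePairs m a c).card := by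
  rw [monotonePairs, Finset.card_biUnion]
  · refine Finset.sum_congr rfl fun a _ => ?_
    rw [Finset.card_biUnion]
    · refine Finset.sum_congr rfl fun c _ => Finset.card_image_of_injective _ ?_
      rintro ⟨b, t⟩ ⟨b', t'⟩ h
      simpa [Fin.snoc_inj] using h
    · intro c _ c' _ hc
      refine Finset.disjoint_left.2 fun p hp hp' => hc ?_
      simp only [Finset.mem_image] at hp hp'
      obtain ⟨q, -, rfl⟩ := hp
      obtain ⟨q', -, h⟩ := hp'
      simp only [Prod.mk.injEq, Fin.snoc_inj, Nat.cast_inj] at h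
      exact h.2.2.symm
  · intro a _ a' _ ha
    refine Finset.disjoint_left.2 fun p hp hp' => ha ?_
    simp only [Finset.mem_biUnion, Finset.mem_image] at hp hp'
    obtain ⟨c, -, q, -, rfl⟩ := hp
    obtain ⟨c', -, q', -, h⟩ := hp'
    simp only [Prod.mk.injEq, Fin.snoc_inj, Nat.cast_inj] at h
    exact h.1.2.symm

theorem sum_Icc_choose_det (m a y : ℕ) (h : a ≤ y) :
    ∑ c ∈ Finset.Icc a y, (((m + a).choose m : ℤ) * (m + c).choose m -
        (m + a).choose (m + 1) * (m + c).choose (c + 1)) =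
      (m + a).choose m * (m + 1 + y).choose (m + 1) -
        (m + a).choose (m + 1) * (m + 1 + y).choose (y + 1) := by
  induction y, h using Nat.le_induction with
  | base =>
    have h1 : (m + 1 + a).choose (m + 1) = (m + a).choose m + (m + a).choose (m + 1) := by
      rw [add_right_comm, Nat.choose_succ_succ]
    have h2 : (m + 1 + a).choose (a + 1) = (m + a).choose a + (m + a).choose (a + 1) := by
      rw [add_right_comm, Nat.choose_succ_succ]
    rw [Finset.Icc_self, Finset.sum_singleton, h1, h2, ← Nat.choose_symm_add]
    push_cast
    ring
  | succ y hay ih =>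
    have h1 : (m + 1 + (y + 1)).choose (m + 1) =
        (m + (y + 1)).choose m + (m + 1 + y).choose (m + 1) := by
      rw [← add_assoc, Nat.choose_succ_succ, add_right_comm m 1 y, add_assoc]
    have h2 : (m + 1 + (y + 1)).choose (y + 1 + 1) =
        (m + 1 + y).choose (y + 1) + (m + (y + 1)).choose (y + 1 + 1) := by
      rw [← add_assoc, Nat.choose_succ_succ, add_right_comm m 1 y, add_assoc]
    rw [← Finset.insert_Icc_right_eq_Icc_add_one (by omega), Finset.sum_insert (by simp), ih, h1, h2]
    push_cast
    ring

theorem sum_range_choose_add (m r x : ℕ) :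
    ∑ a ∈ Finset.range (x + 1), (m + a).choose (m + r) = (m + 1 + x).choose (m + r + 1) := by
  induction x with
  | zero =>
    cases r with
    | zero => simp
    | succ r => simp [Nat.choose_eq_zero_of_lt]
  | succ x ih =>
    rw [Finset.sum_range_succ, ih, ← add_assoc (m + 1) x 1, Nat.choose_succ_succ,
      add_right_comm m 1 x, add_assoc m x 1, add_comm]

theorem card_monotonePairs (m x y : ℕ) (h : x ≤ y) :
    ((monotonePairs m x y).card : ℤ) =
      (m + x).choose m * (m + y).choose m - (m + x).choose (m + 1) * (m + y).choose (y + 1) := by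
  induction m generalizing x y with
  | zero => simp [monotonePairs]
  | succ m ih =>
    rw [card_monotonePairs_succ]
    push_cast
    have key : ∀ a ∈ Finset.range (x + 1),
        ∑ c ∈ Finset.Icc a y, ((monotonePairs m a c).card : ℤ) =
        (m + a).choose m * (m + 1 + y).choose (m + 1) -
        (m + a).choose (m + 1) * (m + 1 + y).choose (y + 1) := by
      intro a ha
      rw [← sum_Icc_choose_det m a y (by simp at ha; omega)]
      exact Finset.sum_congr rfl fun c hc => ih a c (Finset.mem_Icc.1 hc).1
    rw [Finset.sum_congr rfl key, Finset.sum_sub_distrib, ← Finset.sum_mul, ← Finset.sum_mul]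
    have h0 := sum_range_choose_add m 0 x
    have h1 := sum_range_choose_add m 1 x
    simp only [add_zero] at h0
    rw [← h0, ← h1]
    push_cast
    rfl

theorem add_one_mul_choose_det (m N : ℕ) :
    ((m + N + 1 : ℕ) : ℤ) * ((m + N).choose m * (m + N).choose m -
        (m + N).choose (m + 1) * (m + N).choose (N + 1)) =
      (m + N + 1).choose (m + 1) * (m + N + 1).choose (N + 1) := by
  have hs : ((m + N).choose N : ℤ) = (m + N).choose m := by rw [Nat.choose_symm_add]
  have e1 : ((m + N + 1).choose (m + 1) : ℤ) * (m + 1) = (m + N + 1) * (m + N).choose m := by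
    exact_mod_cast (Nat.add_one_mul_choose_eq (m + N) m).symm
  have e2 : ((m + N + 1).choose (N + 1) : ℤ) * (N + 1) = (m + N + 1) * (m + N).choose m := by
    rw [← hs]
    exact_mod_cast (Nat.add_one_mul_choose_eq (m + N) N).symm
  have e3 : ((m + N).choose (m + 1) : ℤ) * (m + 1) = (m + N).choose m * N := by
    have := Nat.choose_succ_right_eq (m + N) m
    rw [Nat.add_sub_cancel_left] at this
    exact_mod_cast this
  have e4 : ((m + N).choose (N + 1) : ℤ) * (N + 1) = (m + N).choose m * m := by
    have := Nat.choose_succ_right_eq (m + N) N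
    rw [Nat.add_sub_cancel] at this
    rw [← hs]
    exact_mod_cast this
  have hpos : ((m : ℤ) + 1) * (N + 1) ≠ 0 := by positivity
  apply mul_right_cancel₀ hpos
  push_cast
  calc _ = ((m : ℤ) + N + 1) * ((m + N).choose m * (m + N).choose m * ((m + 1) * (N + 1)) -
        ((m + N).choose (m + 1) * (m + 1)) * ((m + N).choose (N + 1) * (N + 1))) := by ring
    _ = ((m + N + 1) * (m + N).choose m) * ((m + N + 1) * (m + N).choose m) := by
      rw [e3, e4]; ring
    _ = ((m + N + 1).choose (m + 1) * (m + 1)) * ((m + N + 1).choose (N + 1) * (N + 1)) := by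
      rw [e1, e2]
    _ = _ := by ring

/-- Prepending the first bottom `0` and appending the last top `N` identifies monotone pairs with
parallelogram polyominoes. -/
theorem parallelogramPolyominoes_eq_image (m N : ℕ) :
    {p : (Fin (m + 1) → ℤ) × (Fin (m + 1) → ℤ) |
      p.1 0 = 0 ∧ p.2 (Fin.last m) = N ∧ Monotone p.1 ∧ Monotone p.2 ∧
      (∀ i, p.1 i ≤ p.2 i) ∧ ∀ j : Fin m, p.1 j.succ ≤ p.2 j.castSucc} =
    ((monotonePairs m N N).image fun p =>
      (Fin.cons (α := fun _ => ℤ) 0 p.1, Fin.snoc (α := fun _ => ℤ) p.2 (N : ℤ)) :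
        Finset ((Fin (m + 1) → ℤ) × (Fin (m + 1) → ℤ))) := by
  ext ⟨b, t⟩
  simp only [Set.mem_ofPred_eq, Finset.coe_image, Set.mem_image, Finset.mem_coe,
    mem_monotonePairs, Prod.mk.injEq]
  constructor
  · rintro ⟨hb0, htN, hb, ht, -, hbt⟩
    have htle : ∀ i, t i ≤ N := fun i => htN ▸ ht (Fin.le_last i)
    refine ⟨(Fin.tail b, Fin.init t), ⟨fun i j hij => hb (Fin.succ_le_succ_iff.2 hij),
      fun i j hij => ht (Fin.castSucc_le_castSucc_iff.2 hij), fun i => ⟨?_, hbt i,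
        (hbt i).trans (htle _), htle _⟩⟩, ?_, ?_⟩
    · exact hb0 ▸ hb (Fin.zero_le i.succ)
    · rw [← hb0, Fin.cons_self_tail]
    · rw [← htN, Fin.snoc_init_self]
  · rintro ⟨⟨b, t⟩, ⟨hb, ht, h⟩, rfl, rfl⟩
    have hbm : Monotone (Fin.cons (α := fun _ => ℤ) 0 b : Fin (m + 1) → ℤ) := by
      intro i j hij
      induction i using Fin.cases with
      | zero =>
        induction j using Fin.cases with
        | zero => simp
        | succ j => simpa using (h j).1
      | succ i =>
        induction j using Fin.cases with
        | zero => exact absurd hij (not_le.2 (Fin.succ_pos i))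
        | succ j => simpa using hb (Fin.succ_le_succ_iff.1 hij)
    have hbt : ∀ j : Fin m, (Fin.cons (α := fun _ => ℤ) 0 b : Fin (m + 1) → ℤ) j.succ ≤
        (Fin.snoc (α := fun _ => ℤ) t (N : ℤ) : Fin (m + 1) → ℤ) j.castSucc := by
      intro j
      simpa using (h j).2.1
    refine ⟨rfl, Fin.snoc_last .., hbm,
      (Fin.monotone_snoc_iff _ _).2 ⟨ht, fun i => (h i).2.2.2⟩, fun i => ?_, hbt⟩
    induction i using Fin.lastCases with
    | last =>
      rw [Fin.snoc_last]
      induction Fin.last m using Fin.cases with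
      | zero => simp
      | succ j => simpa using (h j).2.2.1
    | cast i => exact (hbm (Fin.castSucc_lt_succ).le).trans (hbt i)

theorem ncard_parallelogramPolyominoes (m N : ℕ) :
    {p : (Fin (m + 1) → ℤ) × (Fin (m + 1) → ℤ) |
      p.1 0 = 0 ∧ p.2 (Fin.last m) = N ∧ Monotone p.1 ∧ Monotone p.2 ∧
      (∀ i, p.1 i ≤ p.2 i) ∧ ∀ j : Fin m, p.1 j.succ ≤ p.2 j.castSucc}.ncard =
    (monotonePairs m N N).card := by
  rw [parallelogramPolyominoes_eq_image, Set.ncard_coe_finset]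
  refine Finset.card_image_of_injective _ ?_
  rintro ⟨b, t⟩ ⟨b', t'⟩ h
  simpa [Fin.snoc_inj, Fin.cons_inj] using h

/-- For `k, n ≥ 1`, the number of pairs `(b, t)` encoding a
parallelogram polyomino of width `k` and height `n` (bottoms and tops of the columns)
is `g_{k,n} = (1/(k+n-1)) C(k+n-1, k) C(k+n-1, n)`; equivalently `(k+n-1)` times this
number equals `C(k+n-1, k) * C(k+n-1, n)`. -/
theorem parallelogram_polyomino_count_by_width_height
    (k n : ℕ) (hk : 1 ≤ k) (hn : 1 ≤ n) :
    (k + n - 1) * Set.ncard {p : (Fin k → ℤ) × (Fin k → ℤ) |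
      p.1 ⟨0, by omega⟩ = 0 ∧
      p.2 ⟨k - 1, by omega⟩ = (n : ℤ) - 1 ∧
      Monotone p.1 ∧ Monotone p.2 ∧
      (∀ i, p.1 i ≤ p.2 i) ∧
      ∀ j : ℕ, ∀ hj : j + 1 < k, p.1 ⟨j + 1, hj⟩ ≤ p.2 ⟨j, by omega⟩} =
    Nat.choose (k + n - 1) k * Nat.choose (k + n - 1) n := by
  obtain ⟨m, rfl⟩ := Nat.exists_eq_add_of_le' hk
  obtain ⟨N, rfl⟩ := Nat.exists_eq_add_of_le' hn
  have hkn : m + 1 + (N + 1) - 1 = m + N + 1 := by omega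
  have hcard := ncard_parallelogramPolyominoes m N
  rw [hkn]
  convert_to (m + N + 1) * (monotonePairs m N N).card = _ using 2
  · rw [← hcard]
    congr 1
    ext p
    have hN : ((N + 1 : ℕ) : ℤ) - 1 = N := by push_cast; ring
    simp only [Set.mem_ofPred_eq, hN]
    have hj : (∀ j : ℕ, ∀ hj : j + 1 < m + 1, p.1 ⟨j + 1, hj⟩ ≤ p.2 ⟨j, by omega⟩) ↔
        ∀ j : Fin m, p.1 j.succ ≤ p.2 j.castSucc :=
      ⟨fun h j => h j (by omega), fun h j hj => h ⟨j, by omega⟩⟩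
    rw [hj]
    rfl
  · have := add_one_mul_choose_det m N
    rw [← card_monotonePairs m N N le_rfl] at this
    exact_mod_cast this
end

section
/- Let k, n, m ≥ 1. The number s_{k,n,m} of quadruples of integer sequences ((b_1,…,b_k), (t_1,…,t_k), (c_1,…,c_k), (d_1,…,d_k)) such that (b, t) satisfies b_1 = 0, t_k = n − 1, b_j ≤ b_{j+1} and t_j ≤ t_{j+1} for 1 ≤ j ≤ k−1, b_i ≤ t_i for all i, b_{j+1} ≤ t_j for 1 ≤ j ≤ k−1, and (c, d) satisfies the same conditions with n replaced by m, satisfies s_{k,n,m} · k² · (n+k−1) · (m+k−1) = n · m · C(n+k−1, k−1)² · C(m+k−1, k−1)², where C denotes the binomial coefficient. Equivalently, s_{k,n,m} = (n m / (k² (n+k−1)(m+k−1))) · C(n+k−1, k−1)² · C(m+k−1, k−1)². -/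
/-- `(b, t)` encodes a parallelogram polyomino of width `k` and height `n`
(bottoms and tops of the `k` columns, normalized by `b 1 = 0`, total height `n`). -/
def IsParaPolyominoEncoding (k n : ℕ) (hk : 0 < k) (p : (Fin k → ℤ) × (Fin k → ℤ)) : Prop :=
  p.1 ⟨0, hk⟩ = 0 ∧ p.2 ⟨k - 1, by omega⟩ = (n : ℤ) - 1 ∧
  Monotone p.1 ∧ Monotone p.2 ∧ (∀ i, p.1 i ≤ p.2 i) ∧
  ∀ j : ℕ, ∀ hj : j + 1 < k, p.1 ⟨j + 1, hj⟩ ≤ p.2 ⟨j, by omega⟩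

open Finset in
/-- Weakly increasing sequences of length `l` of pairs `(c, t)` with `c ≤ t`, bounded above
by `z`. -/
def orderedPairChains : (l : ℕ) → ℕ × ℕ → Finset (Fin l → ℕ × ℕ)
  | 0, _ => univ
  | l + 1, z => ((Iic z).filter fun w => w.1 ≤ w.2).biUnion fun w =>
      (orderedPairChains l w).image fun p => Fin.snoc (α := fun _ => ℕ × ℕ) p w

theorem mem_orderedPairChains {l : ℕ} {z : ℕ × ℕ} {p : Fin l → ℕ × ℕ} :
    p ∈ orderedPairChains l z ↔ Monotone p ∧ ∀ i, (p i).1 ≤ (p i).2 ∧ p i ≤ z := by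
  induction l generalizing z with
  | zero => simpa [orderedPairChains, Subsingleton.monotone] using Subsingleton.elim _ _
  | succ l ih =>
    simp only [orderedPairChains, Finset.mem_biUnion, Finset.mem_filter, Finset.mem_Iic,
      Finset.mem_image, ih]
    constructor
    · rintro ⟨w, ⟨hwz, hw⟩, q, ⟨hq, hqw⟩, rfl⟩
      refine ⟨fun i j hij => ?_, fun i => ?_⟩
      · induction j using Fin.lastCases with
        | last =>
          induction i using Fin.lastCases with
          | last => rfl
          | cast i => simpa using (hqw i).2
        | cast j =>
          induction i using Fin.lastCases with
          | last => exact absurd hij (Fin.castSucc_lt_last j).not_ge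
          | cast i => simpa using hq (Fin.castSucc_le_castSucc_iff.1 hij)
      · induction i using Fin.lastCases with
        | last => simpa using ⟨hw, hwz⟩
        | cast j => simpa using ⟨(hqw j).1, (hqw j).2.trans hwz⟩
    · rintro ⟨hp, h⟩
      exact ⟨p (Fin.last l), ⟨(h _).2, (h _).1⟩, Fin.init p,
        ⟨fun i j hij => hp (Fin.castSucc_le_castSucc_iff.2 hij),
          fun i => ⟨(h _).1, hp (Fin.le_last _)⟩⟩, Fin.snoc_init_self p⟩

theorem card_orderedPairChains_succ (l : ℕ) (z : ℕ × ℕ) :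
    (orderedPairChains (l + 1) z).card =
      ∑ w ∈ (Finset.Iic z).filter fun w => w.1 ≤ w.2, (orderedPairChains l w).card := by
  rw [orderedPairChains, Finset.card_biUnion]
  · refine Finset.sum_congr rfl fun w _ => Finset.card_image_of_injective _ fun p q h => ?_
    exact (Fin.snoc_injective2 h).1
  · intro w _ w' _ hww'
    rw [Function.onFun, Finset.disjoint_left]
    simp only [Finset.mem_image, not_exists, not_and]
    rintro _ ⟨p, _, rfl⟩ q _ h
    exact hww' (Fin.snoc_injective2 h).2.symm

theorem sum_filter_Iic_fst_le_snd {M : Type*} [AddCommMonoid M] (f : ℕ → ℕ → M) {x y : ℕ}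
    (_hxy : x ≤ y) :
    ∑ w ∈ (Finset.Iic (x, y)).filter (fun w => w.1 ≤ w.2), f w.1 w.2 =
      ∑ c ∈ Finset.range (x + 1), ∑ t ∈ Finset.Ico c (y + 1), f c t := by
  rw [Finset.sum_sigma']
  refine Finset.sum_bij' (fun w _ => ⟨w.1, w.2⟩) (fun s _ => (s.1, s.2)) ?_ ?_ ?_ ?_ ?_ <;>
    simp [Prod.le_def] <;> omega

theorem card_orderedPairChains (l : ℕ) {x y : ℕ} (hxy : x ≤ y) :
    ((orderedPairChains l (x, y)).card : ℤ) =
      (x + l).choose x * (y + l).choose y - (x + l).choose (l + 1) * (y + l).choose (y + 1) := by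
  induction l generalizing x y with
  | zero => simp [orderedPairChains]
  | succ l ih =>
    have pascal (t : ℕ) : ((t + 1 + l).choose (t + 1) : ℤ) =
        (t + l).choose t + (t + l).choose (t + 1) := by
      rw [Nat.add_right_comm, Nat.choose_succ_succ]; push_cast; ring
    have pascal' (t : ℕ) : ((t + 1 + l).choose (l + 1) : ℤ) =
        (t + l).choose t + (t + l).choose (l + 1) := by
      rw [Nat.add_right_comm, Nat.choose_succ_succ, Nat.choose_symm_add]; push_cast; ring
    have pascal'' (t : ℕ) : ((t + 1 + l).choose (l + 2) : ℤ) =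
        (t + l).choose (l + 1) + (t + l).choose (l + 2) := by
      rw [Nat.add_right_comm, Nat.choose_succ_succ]; push_cast; ring
    have inner {c Y : ℕ} (hc : c ≤ Y) : ∑ t ∈ Finset.Ico c (Y + 1),
        (((c + l).choose c : ℤ) * (t + l).choose t
          - (c + l).choose (l + 1) * (t + l).choose (t + 1)) =
        (c + l).choose c * (Y + 1 + l).choose (l + 1)
          - (c + l).choose (l + 1) * (Y + 1 + l).choose (Y + 1) := by
      induction Y, hc using Nat.le_induction with
      | base =>
        rw [Finset.sum_Ico_succ_top le_rfl, Finset.Ico_self, Finset.sum_empty, pascal', pascal]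
        ring
      | succ Y hcY ihY =>
        rw [Finset.sum_Ico_succ_top (by omega), pascal' (Y + 1), pascal (Y + 1)]
        linear_combination ihY
    have outer (X : ℕ) (u v : ℤ) : ∑ c ∈ Finset.range X,
        (((c + l).choose c : ℤ) * u - (c + l).choose (l + 1) * v) =
        (X + l).choose (l + 1) * u - (X + l).choose (l + 2) * v := by
      induction X with
      | zero => simp [Nat.choose_eq_zero_of_lt (show l < l + 2 by omega)]
      | succ X ihX =>
        rw [Finset.sum_range_succ, ihX, pascal', pascal'']
        ring
    rw [card_orderedPairChains_succ]
    push_cast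
    calc
      _ = ∑ w ∈ (Finset.Iic (x, y)).filter (fun w => w.1 ≤ w.2),
          (((w.1 + l).choose w.1 : ℤ) * (w.2 + l).choose w.2
            - (w.1 + l).choose (l + 1) * (w.2 + l).choose (w.2 + 1)) :=
        Finset.sum_congr rfl fun w hw => ih (Finset.mem_filter.1 hw).2
      _ = ∑ c ∈ Finset.range (x + 1), ∑ t ∈ Finset.Ico c (y + 1),
          (((c + l).choose c : ℤ) * (t + l).choose t
            - (c + l).choose (l + 1) * (t + l).choose (t + 1)) :=
        sum_filter_Iic_fst_le_snd (fun c t => ((c + l).choose c : ℤ) * (t + l).choose t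
            - (c + l).choose (l + 1) * (t + l).choose (t + 1)) hxy
      _ = ∑ c ∈ Finset.range (x + 1), (((c + l).choose c : ℤ) * (y + 1 + l).choose (l + 1)
            - (c + l).choose (l + 1) * (y + 1 + l).choose (y + 1)) :=
        Finset.sum_congr rfl fun c hc => inner (by rw [Finset.mem_range] at hc; omega)
      _ = _ := by
        rw [outer, Nat.choose_symm_add (a := x) (b := l + 1),
          Nat.choose_symm_add (a := y) (b := l + 1)]
        simp only [add_assoc, add_comm 1 l]

theorem card_orderedPairChains_self_mul (l N : ℕ) :
    (orderedPairChains l (N, N)).card * (l + 1) * (N + l + 1) =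
      (N + 1) * (N + l + 1).choose l ^ 2 := by
  have hcard := card_orderedPairChains l (le_refl N)
  have h₁ : ((N + l).choose (l + 1) : ℤ) * (l + 1) = (N + l).choose N * N := by
    have := Nat.choose_succ_right_eq (N + l) l
    rw [Nat.add_sub_cancel, ← Nat.choose_symm_add] at this
    exact_mod_cast this
  have h₂ : ((N + l).choose (N + 1) : ℤ) * (N + 1) = (N + l).choose N * l := by
    have := Nat.choose_succ_right_eq (N + l) N
    rw [Nat.add_sub_cancel_left] at this
    exact_mod_cast this
  have h₃ : ((N + l + 1).choose l : ℤ) * (N + 1) = (N + l).choose N * (N + l + 1) := by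
    have := Nat.add_one_mul_choose_eq (N + l) N
    rw [show (N + l + 1).choose (N + 1) = (N + l + 1).choose l from
      Nat.choose_symm_of_eq_add (by omega)] at this
    rw [mul_comm ((N + l).choose N : ℤ)]
    exact_mod_cast this.symm
  zify
  refine mul_right_cancel₀ (b := (N + 1 : ℤ)) (by positivity) ?_
  rw [hcard]
  generalize ((N + l).choose N : ℤ) = a at *
  generalize ((N + l).choose (l + 1) : ℤ) = b at *
  generalize ((N + l).choose (N + 1) : ℤ) = c at *
  generalize ((N + l + 1).choose l : ℤ) = d at *
  linear_combination (-(c * (N + 1) * (N + l + 1)) : ℤ) * h₁ - (a * N * (N + l + 1) : ℤ) * h₂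
    - (d * (N + 1) + a * (N + l + 1) : ℤ) * h₃

/-- The pair of bottom and top sequences with inner bottoms `c` and inner tops `t`, first bottom
`0` and last top `N`. -/
def paraPolyominoOfChain {l : ℕ} (N : ℕ) (p : Fin l → ℕ × ℕ) :
    (Fin (l + 1) → ℤ) × (Fin (l + 1) → ℤ) :=
  (Fin.cons (α := fun _ => ℤ) 0 fun i => ((p i).1 : ℤ),
    Fin.snoc (α := fun _ => ℤ) (fun i => ((p i).2 : ℤ)) (N : ℤ))

theorem paraPolyominoOfChain_injective {l : ℕ} (N : ℕ) :
    Function.Injective (paraPolyominoOfChain (l := l) N) := by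
  intro p q h
  rw [paraPolyominoOfChain, paraPolyominoOfChain, Prod.mk.injEq] at h
  have h₁ := (Fin.cons_injective2 h.1).2
  have h₂ := (Fin.snoc_injective2 h.2).1
  funext i
  exact Prod.ext (by exact_mod_cast congrFun h₁ i) (by exact_mod_cast congrFun h₂ i)

theorem setOf_isParaPolyominoEncoding (l N : ℕ) :
    {p | IsParaPolyominoEncoding (l + 1) (N + 1) l.succ_pos p} =
      paraPolyominoOfChain N '' (orderedPairChains l (N, N) : Set (Fin l → ℕ × ℕ)) := by
  ext ⟨b, t⟩
  simp only [Set.mem_ofPred_eq, Set.mem_image, Finset.mem_coe, mem_orderedPairChains]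
  constructor
  · rintro ⟨hb0, htl, hb, ht, -, hbt⟩
    replace hb0 : b 0 = 0 := hb0
    replace htl : t (Fin.last l) = N := by
      have : t (Fin.last l) = ((N + 1 : ℕ) : ℤ) - 1 := htl
      rw [this]; push_cast; ring
    replace hbt (i : Fin l) : b i.succ ≤ t i.castSucc := hbt i (by omega)
    have hb' (i) : 0 ≤ b i := hb0 ▸ hb (Fin.zero_le i)
    have ht' (i) : t i ≤ N := htl ▸ ht (Fin.le_last i)
    refine ⟨fun i => ((b i.succ).toNat, (t i.castSucc).toNat), ⟨fun i j hij => ?_, fun i => ?_⟩, ?_⟩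
    · exact ⟨Int.toNat_le_toNat (hb (Fin.succ_le_succ_iff.2 hij)),
        Int.toNat_le_toNat (ht (Fin.castSucc_le_castSucc_iff.2 hij))⟩
    · have h₁ := hbt i
      have h₂ := ht' i.castSucc
      exact ⟨Int.toNat_le_toNat h₁, by simp only [Prod.mk_le_mk]; omega⟩
    · refine Prod.ext (funext fun i => ?_) (funext fun i => ?_)
      · induction i using Fin.cases with
        | zero => exact hb0.symm
        | succ i => simpa [paraPolyominoOfChain] using hb' i.succ
      · induction i using Fin.lastCases with
        | last => simpa [paraPolyominoOfChain] using htl.symm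
        | cast i => simpa [paraPolyominoOfChain] using (hb' _).trans (hbt i)
  · rintro ⟨p, ⟨hp, h⟩, hpbt⟩
    rw [paraPolyominoOfChain, Prod.mk.injEq] at hpbt
    obtain ⟨rfl, rfl⟩ := hpbt
    have hb : Monotone (Fin.cons (α := fun _ => ℤ) 0 fun i => ((p i).1 : ℤ)) := by
      intro i j hij
      induction i using Fin.cases with
      | zero => induction j using Fin.cases <;> simp
      | succ i =>
        induction j using Fin.cases with
        | zero => exact absurd hij (Fin.succ_pos i).not_ge
        | succ j => simpa using (hp (Fin.succ_le_succ_iff.1 hij)).1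
    have ht : Monotone (Fin.snoc (α := fun _ => ℤ) (fun i => ((p i).2 : ℤ)) (N : ℤ)) := by
      intro i j hij
      induction j using Fin.lastCases with
      | last =>
        induction i using Fin.lastCases with
        | last => rfl
        | cast i => simpa using (h i).2.2
      | cast j =>
        induction i using Fin.lastCases with
        | last => exact absurd hij (Fin.castSucc_lt_last j).not_ge
        | cast i => simpa using (hp (Fin.castSucc_le_castSucc_iff.1 hij)).2
    have hbt (i : Fin l) : Fin.cons (α := fun _ => ℤ) 0 (fun i => ((p i).1 : ℤ)) i.succ ≤
        Fin.snoc (α := fun _ => ℤ) (fun i => ((p i).2 : ℤ)) (N : ℤ) i.castSucc := by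
      simpa using (h i).1
    refine ⟨rfl, ?_, hb, ht, fun i => ?_, fun j hj => hbt ⟨j, by omega⟩⟩
    · rw [Nat.cast_succ, add_sub_cancel_right]
      exact Fin.snoc_last (α := fun _ => ℤ) (N : ℤ) fun i => ((p i).2 : ℤ)
    · induction i using Fin.lastCases with
      | last =>
        cases l with
        | zero => simp [Fin.snoc]
        | succ l => simpa using (h (Fin.last l)).2.1
      | cast i => exact (hb i.castSucc_lt_succ.le).trans (hbt i)

theorem ncard_isParaPolyominoEncoding_mul {k n : ℕ} (hk : 1 ≤ k) (hn : 1 ≤ n) :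
    {p | IsParaPolyominoEncoding k n hk p}.ncard * k * (n + k - 1) =
      n * (n + k - 1).choose (k - 1) ^ 2 := by
  obtain ⟨l, rfl⟩ := Nat.exists_eq_add_of_le' hk
  obtain ⟨N, rfl⟩ := Nat.exists_eq_add_of_le' hn
  rw [setOf_isParaPolyominoEncoding, Set.ncard_image_of_injective _
    (paraPolyominoOfChain_injective N), Set.ncard_coe_finset, Nat.add_sub_cancel,
    show N + 1 + (l + 1) - 1 = N + l + 1 by omega]
  exact card_orderedPairChains_self_mul l N

/-- For `k, n, m ≥ 1`, the number `s_{k,n,m}` of parallelogram polycubes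
of width `k`, height `n` and depth `m` (encoded by a pair of parallelogram-polyomino
encodings) satisfies
`s_{k,n,m} · k² · (n+k-1) · (m+k-1) = n · m · C(n+k-1, k-1)² · C(m+k-1, k-1)²`. -/
theorem parallelogram_polycube_count_by_width_height_depth
    (k n m : ℕ) (hk : 1 ≤ k) (hn : 1 ≤ n) (hm : 1 ≤ m) :
    Set.ncard {q : ((Fin k → ℤ) × (Fin k → ℤ)) × ((Fin k → ℤ) × (Fin k → ℤ)) |
        IsParaPolyominoEncoding k n hk q.1 ∧ IsParaPolyominoEncoding k m hk q.2} *
      k ^ 2 * (n + k - 1) * (m + k - 1) =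
    n * m * Nat.choose (n + k - 1) (k - 1) ^ 2 * Nat.choose (m + k - 1) (k - 1) ^ 2 := by
  have hprod : {q : ((Fin k → ℤ) × (Fin k → ℤ)) × ((Fin k → ℤ) × (Fin k → ℤ)) |
      IsParaPolyominoEncoding k n hk q.1 ∧ IsParaPolyominoEncoding k m hk q.2} =
      {p | IsParaPolyominoEncoding k n hk p} ×ˢ {p | IsParaPolyominoEncoding k m hk p} := rfl
  have h₁ := ncard_isParaPolyominoEncoding_mul hk hn
  have h₂ := ncard_isParaPolyominoEncoding_mul hk hm
  rw [hprod, Set.ncard_prod]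
  linear_combination ({p | IsParaPolyominoEncoding k m hk p}.ncard * k * (m + k - 1)) * h₁ +
    (n * (n + k - 1).choose (k - 1) ^ 2) * h₂
end

section
/- Let d ≥ 2, k ≥ 1 and n_1, …, n_{d−1} ≥ 1. The number s of (d−1)-tuples of pairs of integer sequences ((b^{(1)},t^{(1)}), …, (b^{(d−1)},t^{(d−1)})), where for each 1 ≤ j ≤ d−1 the pair (b^{(j)}, t^{(j)}) = ((b^{(j)}_1,…,b^{(j)}_k),(t^{(j)}_1,…,t^{(j)}_k)) satisfies b^{(j)}_1 = 0, t^{(j)}_k = n_j − 1, b^{(j)} and t^{(j)} nondecreasing, b^{(j)}_i ≤ t^{(j)}_i for all i, and b^{(j)}_{i+1} ≤ t^{(j)}_i for 1 ≤ i ≤ k−1, satisfies s · k^{d−1} · ∏_{j=1}^{d−1}(n_j+k−1) = ∏_{j=1}^{d−1} n_j · C(n_j+k−1, k−1)², where C denotes the binomial coefficient. Equivalently, s = (1/k^{d−1}) ∏_{j=1}^{d−1} (n_j/(n_j+k−1)) C(n_j+k−1, k−1)². -/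
/-- Pairs of nondecreasing sequences `c ≤ t` of length `m`, with `c` bounded by `x`
and `t` bounded by `y`. -/
def boundedMonotonePairs (m x y : ℕ) : Set ((Fin m → ℕ) × (Fin m → ℕ)) :=
  {p | Monotone p.1 ∧ Monotone p.2 ∧ (∀ i, p.1 i ≤ p.2 i) ∧ (∀ i, p.1 i ≤ x) ∧ ∀ i, p.2 i ≤ y}

theorem boundedMonotonePairs_finite (m x y : ℕ) : (boundedMonotonePairs m x y).Finite :=
  ((Set.finite_Iic fun _ => x).prod (Set.finite_Iic fun _ => y)).subset
    fun _ hp => ⟨hp.2.2.2.1, hp.2.2.2.2⟩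

instance (m x y : ℕ) : Finite (boundedMonotonePairs m x y) :=
  (boundedMonotonePairs_finite m x y).to_subtype

theorem monotone_snoc {α : Type*} [Preorder α] {m : ℕ} {f : Fin m → α} {a : α}
    (hf : Monotone f) (ha : ∀ i, f i ≤ a) :
    Monotone (Fin.snoc f a : Fin (m + 1) → α) := by
  intro i j hij
  induction j using Fin.lastCases with
  | last =>
    induction i using Fin.lastCases with
    | last => exact le_rfl
    | cast i => simpa using ha i
  | cast j =>
    induction i using Fin.lastCases with
    | last => exact absurd hij (not_le.2 (Fin.castSucc_lt_last j))
    | cast i => simpa using hf (Fin.castSucc_le_castSucc_iff.1 hij)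

theorem monotone_cons {α : Type*} [Preorder α] {m : ℕ} {f : Fin m → α} {a : α}
    (hf : Monotone f) (ha : ∀ i, a ≤ f i) :
    Monotone (Fin.cons a f : Fin (m + 1) → α) := by
  intro i j hij
  induction i using Fin.cases with
  | zero =>
    induction j using Fin.cases with
    | zero => exact le_rfl
    | succ j => simpa using ha j
  | succ i =>
    induction j using Fin.cases with
    | zero => exact absurd hij (not_le.2 (Fin.succ_pos i))
    | succ j => simpa using hf (Fin.succ_le_succ_iff.1 hij)

/-- Append the last entries `c` and `t` to a pair of sequences bounded by `c` and `t`. -/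
def boundedMonotonePairsSnoc (m x y : ℕ)
    (s : Σ t : Fin (y + 1), Σ c : Fin (min x t + 1), boundedMonotonePairs m c t) :
    boundedMonotonePairs (m + 1) x y :=
  ⟨(Fin.snoc s.2.2.1.1 (s.2.1 : ℕ), Fin.snoc s.2.2.1.2 (s.1 : ℕ)), by
    obtain ⟨⟨t, ht⟩, ⟨c, hc⟩, ⟨⟨f, g⟩, hf, hg, hfg, hfc, hgt⟩⟩ := s
    replace hc : c < min x t + 1 := hc
    replace hfg : ∀ i, f i ≤ g i := hfg
    replace hfc : ∀ i, f i ≤ c := hfc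
    replace hgt : ∀ i, g i ≤ t := hgt
    refine ⟨monotone_snoc hf hfc, monotone_snoc hg hgt, ?_, ?_, ?_⟩ <;> intro i <;>
      induction i using Fin.lastCases with
      | last => simp only [Fin.snoc_last]; omega
      | cast i =>
        have := hfg i
        have := hfc i
        have := hgt i
        simp only [Fin.snoc_castSucc]
        omega⟩

theorem boundedMonotonePairsSnoc_bijective (m x y : ℕ) :
    Function.Bijective (boundedMonotonePairsSnoc m x y) := by
  constructor
  · rintro ⟨⟨t, ht⟩, ⟨c, hc⟩, ⟨⟨f, g⟩, hp⟩⟩ ⟨⟨t', ht'⟩, ⟨c', hc'⟩, ⟨⟨f', g'⟩, hp'⟩⟩ h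
    have hfst : (Fin.snoc f c : Fin (m + 1) → ℕ) = Fin.snoc f' c' :=
      congrArg (fun p => p.1.1) h
    have hsnd : (Fin.snoc g t : Fin (m + 1) → ℕ) = Fin.snoc g' t' :=
      congrArg (fun p => p.1.2) h
    obtain ⟨rfl, rfl⟩ := Fin.snoc_inj.1 hfst
    obtain ⟨rfl, rfl⟩ := Fin.snoc_inj.1 hsnd
    rfl
  · rintro ⟨⟨f, g⟩, hf, hg, hfg, hfx, hgy⟩
    refine ⟨⟨⟨g (Fin.last m), Nat.lt_succ_of_le (hgy _)⟩,
      ⟨f (Fin.last m), Nat.lt_succ_of_le (le_min (hfx _) (hfg _))⟩,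
      ⟨(Fin.init f, Fin.init g),
        fun _ _ h => hf (Fin.castSucc_le_castSucc_iff.2 h),
        fun _ _ h => hg (Fin.castSucc_le_castSucc_iff.2 h),
        fun i => hfg i.castSucc,
        fun i => hf (Fin.le_last i.castSucc),
        fun i => hg (Fin.le_last i.castSucc)⟩⟩, ?_⟩
    simp [boundedMonotonePairsSnoc]

theorem card_boundedMonotonePairs_succ (m x y : ℕ) :
    Nat.card (boundedMonotonePairs (m + 1) x y) =
      ∑ t ∈ Finset.range (y + 1), ∑ c ∈ Finset.range (min x t + 1),
        Nat.card (boundedMonotonePairs m c t) := by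
  rw [← Nat.card_eq_of_bijective _ (boundedMonotonePairsSnoc_bijective m x y), Nat.card_sigma,
    ← Fin.sum_univ_eq_sum_range (fun t => ∑ c ∈ Finset.range (min x t + 1),
        Nat.card (boundedMonotonePairs m c t))]
  refine Finset.sum_congr rfl fun t _ => ?_
  rw [Nat.card_sigma, ← Fin.sum_univ_eq_sum_range
    (fun c => Nat.card (boundedMonotonePairs m c t))]

theorem sum_choose_sub_choose (m x y : ℕ) :
    ∑ c ∈ Finset.range (x + 1), (((c + m).choose m : ℤ) * (y + m).choose m -
        (c + m).choose (m + 1) * (y + m).choose (y + 1)) =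
      (x + m + 1).choose (m + 1) * (y + m).choose m -
        (x + m + 1).choose (m + 2) * (y + m).choose (y + 1) := by
  induction x with
  | zero => simp
  | succ x ih =>
    rw [Finset.sum_range_succ, ih, show x + 1 + m = x + m + 1 by ring,
      Nat.choose_succ_succ (x + m + 1) m, Nat.choose_succ_succ (x + m + 1) (m + 1)]
    push_cast
    ring

theorem sum_sum_choose_sub_choose (m x y : ℕ) (hxy : x ≤ y) :
    ∑ t ∈ Finset.range (y + 1), ∑ c ∈ Finset.range (min x t + 1),
        (((c + m).choose m : ℤ) * (t + m).choose m -
          (c + m).choose (m + 1) * (t + m).choose (t + 1)) =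
      (x + m + 1).choose (m + 1) * (y + m + 1).choose (m + 1) -
        (x + m + 1).choose (m + 2) * (y + m + 1).choose (y + 1) := by
  simp only [sum_choose_sub_choose]
  have step : ∀ z w : ℕ, ((z + m + 1).choose (m + 1) * (w + 1 + m + 1).choose (m + 1) -
        (z + m + 1).choose (m + 2) * (w + 1 + m + 1).choose (w + 1 + 1) : ℤ) =
      ((z + m + 1).choose (m + 1) * (w + m + 1).choose (m + 1) -
        (z + m + 1).choose (m + 2) * (w + m + 1).choose (w + 1)) +
      ((z + m + 1).choose (m + 1) * (w + 1 + m).choose m -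
        (z + m + 1).choose (m + 2) * (w + 1 + m).choose (w + 1 + 1)) := by
    intro z w
    rw [show w + 1 + m = w + m + 1 by ring, Nat.choose_succ_succ (w + m + 1) m,
      Nat.choose_succ_succ (w + m + 1) (w + 1)]
    push_cast
    ring
  induction y generalizing x with
  | zero =>
    obtain rfl : x = 0 := by omega
    simp
  | succ y ih =>
    rw [Finset.sum_range_succ, step x y, min_eq_left hxy]
    congr 1
    rcases hxy.lt_or_eq with h | rfl
    · exact ih x (by omega)
    · have hmin : ∀ t ∈ Finset.range (y + 1), min (y + 1) t = min y t := by
        intro t ht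
        have := Finset.mem_range.1 ht
        omega
      rw [Finset.sum_congr rfl fun t ht => by rw [hmin t ht], ih y le_rfl,
        show y + 1 + m + 1 = (y + m + 1) + 1 by ring, Nat.choose_succ_succ (y + m + 1) m,
        Nat.choose_succ_succ (y + m + 1) (m + 1),
        ← Nat.choose_symm_of_eq_add (show y + m + 1 = m + (y + 1) by ring)]
      push_cast
      ring

theorem card_boundedMonotonePairs (m x y : ℕ) (hxy : x ≤ y) :
    (Nat.card (boundedMonotonePairs m x y) : ℤ) =
      (x + m).choose m * (y + m).choose m -
        (x + m).choose (m + 1) * (y + m).choose (y + 1) := by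
  induction m generalizing x y with
  | zero =>
    have : boundedMonotonePairs 0 x y = Set.univ :=
      Set.eq_univ_of_forall fun p =>
        ⟨fun i => i.elim0, fun i => i.elim0, fun i => i.elim0, fun i => i.elim0, fun i => i.elim0⟩
    simp [this]
  | succ m ih =>
    rw [card_boundedMonotonePairs_succ]
    push_cast
    refine Eq.trans (Finset.sum_congr rfl fun t _ => Finset.sum_congr rfl fun c hc => ih c t ?_)
      (sum_sum_choose_sub_choose m x y hxy)
    have := Finset.mem_range.1 hc
    omega

theorem card_boundedMonotonePairs_diag (m x : ℕ) :
    Nat.card (boundedMonotonePairs m x x) * (m + 1) * (x + 1 + m) =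
      (x + 1) * (x + 1 + m).choose m ^ 2 := by
  have h := card_boundedMonotonePairs m x x le_rfl
  have h1 : ((x + m).choose (m + 1) * (m + 1) : ℤ) = (x + m).choose m * x := by
    have := Nat.choose_succ_right_eq (x + m) m
    rw [Nat.add_sub_cancel] at this
    exact_mod_cast this
  have h2 : ((x + m).choose (x + 1) * (x + 1) : ℤ) = (x + m).choose m * m := by
    have := Nat.choose_succ_right_eq (x + m) x
    rw [Nat.add_sub_cancel_left, Nat.choose_symm_add] at this
    exact_mod_cast this
  have h3 : ((x + 1 + m).choose m * (x + 1) : ℤ) = (x + m + 1) * (x + m).choose m := by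
    have := Nat.add_one_mul_choose_eq (x + m) x
    rw [Nat.choose_symm_add, show x + m + 1 = (x + 1) + m by ring, Nat.choose_symm_add] at this
    zify at this
    linear_combination -this
  have hx : (x + 1 : ℤ) ≠ 0 := by positivity
  zify
  apply mul_right_cancel₀ hx
  generalize (Nat.card (boundedMonotonePairs m x x) : ℤ) = N at *
  generalize ((x + m).choose (m + 1) : ℤ) = A at *
  generalize ((x + m).choose (x + 1) : ℤ) = B at *
  generalize ((x + m).choose m : ℤ) = P at *
  generalize ((x + 1 + m).choose m : ℤ) = C at *
  have h4 : N * (m + 1) * (x + 1) = P ^ 2 * (m + x + 1) := by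
    rw [h]
    linear_combination -(B * (x + 1)) * h1 - P * x * h2
  linear_combination (x + 1 + m : ℤ) * h4 - (C * (x + 1) + (x + m + 1) * P) * h3

/-- The encoding determined by the bottoms of all columns but the first
and the tops of all columns but the last. -/
def paraPolyominoOfPair (m x : ℕ) (p : (Fin m → ℕ) × (Fin m → ℕ)) :
    (Fin (m + 1) → ℤ) × (Fin (m + 1) → ℤ) :=
  (Fin.cons 0 fun i => (p.1 i : ℤ), Fin.snoc (fun i => (p.2 i : ℤ)) (x : ℤ))

theorem paraPolyominoOfPair_injective (m x : ℕ) :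
    Function.Injective (paraPolyominoOfPair m x) := by
  rintro ⟨f, g⟩ ⟨f', g'⟩ h
  obtain ⟨h1, h2⟩ := Prod.ext_iff.1 h
  refine Prod.ext (funext fun i => ?_) (funext fun i => ?_)
  · simpa [paraPolyominoOfPair] using congrFun h1 i.succ
  · simpa [paraPolyominoOfPair] using congrFun h2 i.castSucc

theorem setOf_isParaPolyominoEncoding_s11 (m x : ℕ) (hk : 0 < m + 1) :
    {p | IsParaPolyominoEncoding (m + 1) (x + 1) hk p} =
      paraPolyominoOfPair m x '' boundedMonotonePairs m x x := by
  ext ⟨b, t⟩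
  constructor
  · rintro ⟨hb0, htl, hb, ht, hbt, hc⟩
    replace hb0 : b 0 = 0 := hb0
    replace htl : t (Fin.last m) = x := by simpa using! htl
    replace hc : ∀ i : Fin m, b i.succ ≤ t i.castSucc := fun i => hc i (by omega)
    have hb_nonneg : ∀ i, 0 ≤ b i := fun i => hb0 ▸ hb (Fin.zero_le i)
    have ht_nonneg : ∀ i, 0 ≤ t i := fun i => (hb_nonneg i).trans (hbt i)
    have htx : ∀ i, t i ≤ x := fun i => htl ▸ ht (Fin.le_last i)
    lift b to Fin (m + 1) → ℕ using hb_nonneg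
    lift t to Fin (m + 1) → ℕ using ht_nonneg
    simp only [Nat.cast_le, Nat.cast_inj, Nat.cast_eq_zero] at *
    refine ⟨(Fin.tail b, Fin.init t), ⟨?_, ?_, hc, ?_, fun i => htx _⟩, ?_⟩
    · exact fun i j h => Nat.cast_le.1 (hb (Fin.succ_le_succ_iff.2 h))
    · exact fun i j h => Nat.cast_le.1 (ht (Fin.castSucc_le_castSucc_iff.2 h))
    · exact fun i => (hc i).trans (htx _)
    · refine Prod.ext (funext fun i => ?_) (funext fun i => ?_)
      · induction i using Fin.cases with
        | zero => simp [paraPolyominoOfPair, hb0]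
        | succ i => simp [paraPolyominoOfPair, Fin.tail]
      · induction i using Fin.lastCases with
        | last => simp [paraPolyominoOfPair, htl]
        | cast i => simp [paraPolyominoOfPair, Fin.init]
  · rintro ⟨⟨f, g⟩, ⟨hf, hg, hfg, hfx, hgx⟩, h⟩
    obtain ⟨rfl, rfl⟩ := Prod.ext_iff.1 h
    simp only at hf hg hfg hfx hgx
    have hb : Monotone (paraPolyominoOfPair m x (f, g)).1 :=
      monotone_cons (fun i j hij => Nat.cast_le.2 (hf hij)) fun i => Nat.cast_nonneg _
    have ht : Monotone (paraPolyominoOfPair m x (f, g)).2 :=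
      monotone_snoc (fun i j hij => Nat.cast_le.2 (hg hij)) fun i => Nat.cast_le.2 (hgx i)
    have hc : ∀ i : Fin m, (paraPolyominoOfPair m x (f, g)).1 i.succ ≤
        (paraPolyominoOfPair m x (f, g)).2 i.castSucc := fun i => by
      simpa [paraPolyominoOfPair] using hfg i
    have htl : (paraPolyominoOfPair m x (f, g)).2 (Fin.last m) = x := by
      simp [paraPolyominoOfPair]
    refine ⟨rfl, ?_, hb, ht, fun i => ?_, fun j hj => hc ⟨j, by omega⟩⟩
    · simpa using! htl
    · induction i using Fin.lastCases with
      | last =>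
        rw [htl]
        induction (Fin.last m) using Fin.cases with
        | zero => simp [paraPolyominoOfPair]
        | succ i => simpa [paraPolyominoOfPair] using hfx i
      | cast i => exact (hb (Fin.castSucc_le_succ i)).trans (hc i)

theorem ncard_isParaPolyominoEncoding (k n : ℕ) (hk : 0 < k) (hn : 1 ≤ n) :
    {p | IsParaPolyominoEncoding k n hk p}.ncard * k * (n + k - 1) =
      n * (n + k - 1).choose (k - 1) ^ 2 := by
  obtain ⟨m, rfl⟩ := Nat.exists_eq_add_of_le' hk
  obtain ⟨x, rfl⟩ := Nat.exists_eq_add_of_le' hn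
  rw [setOf_isParaPolyominoEncoding_s11,
    Set.ncard_image_of_injective _ (paraPolyominoOfPair_injective m x)]
  exact card_boundedMonotonePairs_diag m x

/-- For `d ≥ 2`, `k ≥ 1` and heights `n₁, …, n_{d-1} ≥ 1`, the number
`s` of parallelogram polyhypercubes of dimension `d`, width `k` and `j`-th height `n j`
(encoded by `d-1` parallelogram-polyomino encodings) satisfies
`s · k^{d-1} · ∏_j (n_j + k - 1) = ∏_j n_j · C(n_j + k - 1, k - 1)²`. -/
theorem parallelogram_polyhypercube_count_by_width_heights
    (d k : ℕ) (hd : 2 ≤ d) (hk : 1 ≤ k) (n : Fin (d - 1) → ℕ) (hn : ∀ j, 1 ≤ n j) :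
    Set.ncard {q : Fin (d - 1) → (Fin k → ℤ) × (Fin k → ℤ) |
        ∀ j, IsParaPolyominoEncoding k (n j) hk (q j)} *
      k ^ (d - 1) * ∏ j, (n j + k - 1) =
    ∏ j, n j * Nat.choose (n j + k - 1) (k - 1) ^ 2 := by
  have hcard : Set.ncard {q : Fin (d - 1) → (Fin k → ℤ) × (Fin k → ℤ) |
      ∀ j, IsParaPolyominoEncoding k (n j) hk (q j)} =
      ∏ j, {p | IsParaPolyominoEncoding k (n j) hk p}.ncard := by
    rw [← Nat.card_coe_set_eq]
    exact (Nat.card_congr (Equiv.subtypePiEquivPi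
      (p := fun j => IsParaPolyominoEncoding k (n j) hk))).trans Nat.card_pi
  have hpow : k ^ (d - 1) = ∏ _j : Fin (d - 1), k := by simp
  rw [hcard, hpow, ← Finset.prod_mul_distrib, ← Finset.prod_mul_distrib]
  exact Finset.prod_congr rfl fun j _ => ncard_isParaPolyominoEncoding k (n j) hk (hn j)
end
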